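/- Let d ≥ 1, 0 < s < 1, and let f : [−1,1] → ℝ be C^{1,α} with α > max{0, 1−2s}. Let u be a stable solution of (−Δ)^s u = f(u) in ℝ^d with |u| ≤ 1. Then there is a constant C = C(d,s) such that for every unit vector v ∈ ℝ^d and every R ≥ 1: ( ∫_{B_{1/2}} (∂_v u(x))₊ dx ) · ( ∫_{B_{1/2}} (∂_v u(y))₋ dy ) ≤ C · J^s(u, B_R) / R², where ∂_v u is the directional derivative of u along v and a₊ = max{a,0}, a₋ = max{−a,0} denote positive and negative parts. -/

import Mathlib

open MeasureTheory Metric Set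
open scoped ENNReal NNReal

/-- The fractional `s`-energy `J^s(u,Ω)` of `u : ℝ^d → ℝ` on an open set `Ω`:
`J^s(u,Ω) = ∬_{(ℝ^d×ℝ^d)∖(Ωᶜ×Ωᶜ)} |u(x)−u(y)|²/|x−y|^{d+2s} dy dx`, valued in `[0,∞]`. -/
noncomputable def Js (d : ℕ) (s : ℝ) (u : EuclideanSpace ℝ (Fin d) → ℝ)
    (Ω : Set (EuclideanSpace ℝ (Fin d))) : ℝ≥0∞ :=
  ∫⁻ p : EuclideanSpace ℝ (Fin d) × EuclideanSpace ℝ (Fin d) in (Ωᶜ ×ˢ Ωᶜ)ᶜ,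
    ENNReal.ofReal ((u p.1 - u p.2)^2 / ‖p.1 - p.2‖ ^ ((d : ℝ) + 2*s))

/-- The normalizing constant `C(d,s) = 2^{2s} Γ(d/2+s) / (π^{d/2} |Γ(−s)|)` of the fractional
Laplacian, which normalizes its Fourier symbol to `|ξ|^{2s}`. -/
noncomputable def fracC (d : ℕ) (s : ℝ) : ℝ :=
  2 ^ (2*s) * Real.Gamma ((d : ℝ)/2 + s) / (Real.pi ^ ((d : ℝ)/2) * |Real.Gamma (-s)|)

/-- `f : [−1,1] → ℝ` is `C^{1,α}`: it has derivative `f'` on `[−1,1]` and `f'` is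
`α`-Hölder continuous on `[−1,1]`. -/
def IsC1Alpha (f f' : ℝ → ℝ) (α : ℝ) : Prop :=
  (∀ x ∈ Set.Icc (-1 : ℝ) 1, HasDerivAt f (f' x) x) ∧
  ∃ Cα : ℝ, 0 ≤ Cα ∧ ∀ x ∈ Set.Icc (-1 : ℝ) 1, ∀ y ∈ Set.Icc (-1 : ℝ) 1,
    |f' x - f' y| ≤ Cα * |x - y| ^ α

/-- `u ∈ C²(ℝ^d)` with `|u| ≤ 1` is a stable solution of `(−Δ)^s u = f(u)` in `ℝ^d`:
the equation `(C(d,s)/2)∫ (2u(x)−u(x+y)−u(x−y))/|y|^{d+2s} dy = f(u(x))` holds pointwise and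
for every `η ∈ C_c^∞(ℝ^d)` one has
`(C(d,s)/2) ∬ |η(x)−η(y)|²/|x−y|^{d+2s} dx dy ≥ ∫ f'(u(x)) η(x)² dx`. -/
def IsStableSolution (d : ℕ) (s : ℝ) (f f' : ℝ → ℝ)
    (u : EuclideanSpace ℝ (Fin d) → ℝ) : Prop :=
  ContDiff ℝ 2 u ∧ (∀ x, |u x| ≤ 1) ∧
  (∀ x : EuclideanSpace ℝ (Fin d),
    fracC d s / 2 * ∫ y : EuclideanSpace ℝ (Fin d),
      (2 * u x - u (x + y) - u (x - y)) / ‖y‖ ^ ((d : ℝ) + 2*s) = f (u x)) ∧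
  (∀ η : EuclideanSpace ℝ (Fin d) → ℝ, ContDiff ℝ (⊤ : ℕ∞) η → HasCompactSupport η →
    ∫ x : EuclideanSpace ℝ (Fin d), f' (u x) * (η x)^2 ≤
      fracC d s / 2 * ∫ x : EuclideanSpace ℝ (Fin d), ∫ y : EuclideanSpace ℝ (Fin d),
        (η x - η y)^2 / ‖x - y‖ ^ ((d : ℝ) + 2*s))

abbrev EE (d : ℕ) := EuclideanSpace ℝ (Fin d)

/-- the kernel -/
noncomputable def KK (d : ℕ) (s : ℝ) (z : EE d) : ℝ := (‖z‖ ^ ((d : ℝ) + 2*s))⁻¹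

noncomputable def kap (d : ℕ) (s : ℝ) (z : EE d) : ℝ := min 1 (‖z‖^2) * KK d s z

lemma KK_nonneg (d : ℕ) (s : ℝ) (z : EE d) : 0 ≤ KK d s z := by
  unfold KK; positivity

lemma kap_nonneg (d : ℕ) (s : ℝ) (z : EE d) : 0 ≤ kap d s z := by
  unfold kap; exact mul_nonneg (le_min zero_le_one (by positivity)) (KK_nonneg d s z)

lemma KK_meas (d : ℕ) (s : ℝ) : Measurable (KK d s) := by
  unfold KK; fun_prop

lemma KK_neg (d : ℕ) (s : ℝ) (z : EE d) : KK d s (-z) = KK d s z := by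
  unfold KK; simp

lemma kap_integrable (d : ℕ) (hd : 1 ≤ d) (s : ℝ) (hs0 : 0 < s) (hs1 : s < 1) :
    Integrable (kap d s) := by
  haveI : Nonempty (Fin d) := ⟨⟨0, hd⟩⟩
  haveI : Nontrivial (EE d) := inferInstance
  have h := integrable_fun_norm_addHaar (volume : Measure (EE d))
    (f := fun r : ℝ => min 1 (r^2) * (r ^ ((d : ℝ) + 2*s))⁻¹)
  refine h.2 ?_
  have hfr : Module.finrank ℝ (EE d) = d := by simp
  rw [hfr]
  have hu : Ioi (0:ℝ) = Ioc 0 1 ∪ Ioi 1 := by rw [Ioc_union_Ioi_eq_Ioi zero_le_one]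
  have hpow : ∀ y : ℝ, 0 < y → y ^ (d-1) * (y ^ ((d : ℝ) + 2*s))⁻¹ = y ^ (-1 - 2*s) := by
    intro y hy
    rw [← Real.rpow_natCast, ← Real.rpow_neg hy.le, ← Real.rpow_add hy]
    congr 1
    push_cast [Nat.cast_sub hd]; ring
  rw [hu]
  refine IntegrableOn.union ?_ ?_
  · have h1 : IntegrableOn (fun y : ℝ => y ^ (1 - 2*s)) (Ioc 0 1) := by
      have := (intervalIntegral.intervalIntegrable_rpow' (r := 1 - 2*s) (by linarith) (a := 0) (b := 1))
      rwa [intervalIntegrable_iff_integrableOn_Ioc_of_le zero_le_one] at this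
    refine h1.congr_fun ?_ measurableSet_Ioc
    intro y hy
    have hy0 : 0 < y := hy.1
    have : min 1 (y^2) = y^2 := min_eq_right (by nlinarith [hy.2])
    simp only [smul_eq_mul, this]
    have e := hpow y hy0
    rw [mul_left_comm, e, ← Real.rpow_natCast y 2, ← Real.rpow_add hy0]
    congr 1; push_cast; ring
  · have h1 : IntegrableOn (fun y : ℝ => y ^ (-1 - 2*s)) (Ioi 1) :=
      integrableOn_Ioi_rpow_of_lt (by linarith) one_pos
    refine h1.congr_fun ?_ measurableSet_Ioi
    intro y hy
    have hy1 : 1 < y := hy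
    have : min 1 (y^2) = 1 := min_eq_left (by nlinarith)
    simp only [smul_eq_mul, this, one_mul]
    exact (hpow y (by linarith)).symm

noncomputable def dom (d : ℕ) (s r : ℝ) (p : EE d × EE d) : ℝ :=
  ((ball (0 : EE d) r).indicator (fun _ => (1:ℝ)) p.1
    + (ball (0 : EE d) r).indicator (fun _ => (1:ℝ)) (p.1 + p.2)) * kap d s p.2

lemma dom_nonneg (d : ℕ) (s r : ℝ) (p : EE d × EE d) : 0 ≤ dom d s r p := by
  unfold dom
  refine mul_nonneg (add_nonneg ?_ ?_) (kap_nonneg _ _ _) <;>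
  exact indicator_nonneg (fun _ _ => zero_le_one) _

lemma dom_ge (d : ℕ) (s r : ℝ) (p : EE d × EE d) (h : ‖p.1‖ < r ∨ ‖p.1 + p.2‖ < r) :
    kap d s p.2 ≤ dom d s r p := by
  unfold dom
  have := kap_nonneg d s p.2
  have h0 : ∀ x : EE d, 0 ≤ (ball (0 : EE d) r).indicator (fun _ => (1:ℝ)) x := fun x =>
    indicator_nonneg (fun _ _ => zero_le_one) _
  rcases h with h | h
  · have e : (ball (0 : EE d) r).indicator (fun _ => (1:ℝ)) p.1 = 1 :=
      indicator_of_mem (by simpa using h) _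
    nlinarith [h0 (p.1+p.2)]
  · have e : (ball (0 : EE d) r).indicator (fun _ => (1:ℝ)) (p.1+p.2) = 1 :=
      indicator_of_mem (by simpa using h) _
    nlinarith [h0 (p.1)]

lemma dom_integrable (d : ℕ) (hd : 1 ≤ d) (s : ℝ) (hs0 : 0 < s) (hs1 : s < 1) (r : ℝ) :
    Integrable (dom d s r) := by
  have hk := kap_integrable d hd s hs0 hs1
  have hi : Integrable ((ball (0 : EE d) r).indicator (fun _ => (1:ℝ))) := by
    rw [integrable_indicator_iff measurableSet_ball]
    exact integrableOn_const (by exact measure_ball_lt_top.ne) 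
  have h1 : Integrable (fun p : EE d × EE d =>
    (ball (0 : EE d) r).indicator (fun _ => (1:ℝ)) p.1 * kap d s p.2) := hi.mul_prod hk
  have h2 : Integrable (fun p : EE d × EE d =>
    (ball (0 : EE d) r).indicator (fun _ => (1:ℝ)) (p.1 + p.2) * kap d s p.2) := by
    have mp := measurePreserving_add_prod (volume : Measure (EE d)) (volume : Measure (EE d))
    exact mp.integrable_comp_of_integrable h1
  refine (h1.add h2).congr (Filter.Eventually.of_forall fun p => ?_)
  simp [dom, add_mul]

/-- master integrability -/
lemma int_of_bound (d : ℕ) (hd : 1 ≤ d) (s : ℝ) (hs0 : 0 < s) (hs1 : s < 1) (r M : ℝ) (hM : 0 ≤ M)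
    (F : EE d × EE d → ℝ) (hF : Measurable F)
    (h0 : ∀ p : EE d × EE d, r ≤ ‖p.1‖ → r ≤ ‖p.1 + p.2‖ → F p = 0)
    (hb : ∀ p : EE d × EE d, |F p| ≤ M * min 1 (‖p.2‖^2)) :
    Integrable (fun p : EE d × EE d => F p * KK d s p.2) ∧
    ∀ p : EE d × EE d, |F p * KK d s p.2| ≤ M * dom d s r p := by
  have key : ∀ p : EE d × EE d, |F p * KK d s p.2| ≤ M * dom d s r p := by
    intro p
    by_cases h : ‖p.1‖ < r ∨ ‖p.1 + p.2‖ < r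
    · rw [abs_mul, abs_of_nonneg (KK_nonneg d s p.2)]
      calc |F p| * KK d s p.2 ≤ (M * min 1 (‖p.2‖^2)) * KK d s p.2 :=
            mul_le_mul_of_nonneg_right (hb p) (KK_nonneg d s p.2)
        _ = M * kap d s p.2 := by unfold kap; ring
        _ ≤ _ := mul_le_mul_of_nonneg_left (dom_ge d s r p h) hM
    · push Not at h
      rw [h0 p h.1 h.2]; simp
      exact mul_nonneg hM (dom_nonneg _ _ _ _)
  refine ⟨?_, key⟩
  refine ((dom_integrable d hd s hs0 hs1 r).const_mul M).mono' ?_ (Filter.Eventually.of_forall key)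
  exact (hF.mul ((KK_meas d s).comp measurable_snd)).aestronglyMeasurable

/-- Lipschitz, bounded, supported in a ball -/
structure Good (d : ℕ) (r L M : ℝ) (η : EE d → ℝ) : Prop where
  lip : ∀ x y, |η x - η y| ≤ L * ‖x - y‖
  supp : ∀ x, r ≤ ‖x‖ → η x = 0
  bd : ∀ x, |η x| ≤ M
  L0 : 0 ≤ L

lemma Good.cont {d : ℕ} {r L M : ℝ} {η : EE d → ℝ} (h : Good d r L M η) : Continuous η := by
  refine (LipschitzWith.of_dist_le_mul (K := ⟨L, h.L0⟩) fun x y => ?_).continuous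
  rw [Real.dist_eq, dist_eq_norm]; exact h.lip x y

lemma Good.M0 {d : ℕ} {r L M : ℝ} {η : EE d → ℝ} (h : Good d r L M η) : 0 ≤ M :=
  (abs_nonneg _).trans (h.bd 0)

lemma Good.cs {d : ℕ} {r L M : ℝ} {η : EE d → ℝ} (h : Good d r L M η) : HasCompactSupport η :=
  HasCompactSupport.of_support_subset_isCompact (isCompact_closedBall (0 : EE d) r) (by
    intro x hx
    by_contra hc
    simp only [mem_closedBall, dist_zero_right, not_le] at hc
    exact hx (h.supp x hc.le))

lemma Good.mono {d : ℕ} {r r' L M : ℝ} {η : EE d → ℝ} (h : Good d r L M η) (hr : r ≤ r') :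
    Good d r' L M η := ⟨h.lip, fun x hx => h.supp x (hr.trans hx), h.bd, h.L0⟩

lemma Good.sq_bd {d : ℕ} {r L M : ℝ} {η : EE d → ℝ} (h : Good d r L M η) (x z : EE d) :
    (η x - η (x + z))^2 ≤ (L^2 + 4*M^2) * min 1 (‖z‖^2) := by
  have h1 := h.lip x (x+z)
  rw [show x - (x+z) = -z by abel, norm_neg] at h1
  have h2 : |η x - η (x+z)| ≤ 2*M := by
    have := abs_sub (η x) (η (x+z)); linarith [h.bd x, h.bd (x+z)]
  rw [← sq_abs]
  have h3 := abs_nonneg (η x - η (x+z))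
  have a1 : |η x - η (x+z)|^2 ≤ L^2 * ‖z‖^2 := by
    rw [← mul_pow]; exact pow_le_pow_left₀ h3 h1 2
  have a2 : |η x - η (x+z)|^2 ≤ (2*M)^2 := pow_le_pow_left₀ h3 h2 2
  rcases le_total 1 (‖z‖^2) with h | h
  · rw [min_eq_left h]; nlinarith [sq_nonneg L]
  · rw [min_eq_right h]; nlinarith [sq_nonneg M, sq_nonneg ‖z‖]

lemma Good.int_sq {d : ℕ} {r L M : ℝ} {η : EE d → ℝ} (h : Good d r L M η)
    (hd : 1 ≤ d) (s : ℝ) (hs0 : 0 < s) (hs1 : s < 1) :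
    Integrable (fun p : EE d × EE d => (η p.1 - η (p.1 + p.2))^2 * KK d s p.2) ∧
    ∀ p : EE d × EE d, |(η p.1 - η (p.1 + p.2))^2 * KK d s p.2| ≤ (L^2 + 4*M^2) * dom d s r p := by
  have hc := h.cont
  refine int_of_bound d hd s hs0 hs1 r (L^2 + 4*M^2) (by positivity) _ ?_ ?_ ?_
  · exact Continuous.measurable (by fun_prop)
  · intro p h1 h2; rw [h.supp _ h1, h.supp _ h2]; simp
  · intro p; rw [abs_of_nonneg (sq_nonneg _)]; exact h.sq_bd _ _


lemma Good.mollify {d : ℕ} {r L M : ℝ} {η : EE d → ℝ} (h : Good d r L M η) (ε : ℝ) (hε : 0 < ε)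
    (hε1 : ε ≤ 1) :
    ∃ ζ : EE d → ℝ, ContDiff ℝ (⊤ : ℕ∞) ζ ∧ Good d (r+1) L M ζ ∧ ∀ x, |ζ x - η x| ≤ L * ε := by
  let φ : ContDiffBump (0 : EE d) := ⟨ε/2, ε, by positivity, by linarith⟩
  let ρ := φ.normed (volume : Measure (EE d))
  have hc := h.cont
  have hρc : Continuous ρ := φ.continuous_normed
  have hρs : HasCompactSupport ρ := φ.hasCompactSupport_normed
  have hint : ∀ x, Integrable (fun t => ρ t * η (x - t)) := fun x =>
    Continuous.integrable_of_hasCompactSupport (by fun_prop) (hρs.mul_right)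
  have hρi : Integrable ρ := φ.integrable_normed
  have hρ1 : ∫ t, ρ t = 1 := φ.integral_normed
  have hρ0 : ∀ t, 0 ≤ ρ t := fun t => φ.nonneg_normed t
  have hρz : ∀ t, ε ≤ ‖t‖ → ρ t = 0 := by
    intro t ht
    by_contra hne
    have : t ∈ Function.support ρ := hne
    rw [φ.support_normed_eq] at this
    simp at this
    exact absurd this (not_lt.2 ht)
  have gen : ∀ (g : EE d → ℝ) (c : ℝ), (∀ t, |ρ t * g t| ≤ c * ρ t) → |∫ t, ρ t * g t| ≤ c := by
    intro g c hg
    calc |∫ t, ρ t * g t| ≤ ∫ t, c * ρ t := by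
          rw [← Real.norm_eq_abs]
          exact norm_integral_le_of_norm_le (hρi.const_mul c) (Filter.Eventually.of_forall hg)
      _ = c := by rw [integral_const_mul, hρ1, mul_one]
  refine ⟨fun x => ∫ t, ρ t * η (x - t), ?_, ⟨?_, ?_, ?_, h.L0⟩, ?_⟩
  · have := HasCompactSupport.contDiff_convolution_left (n := (⊤ : ℕ∞)) (ContinuousLinearMap.lsmul ℝ ℝ)
      (μ := (volume : Measure (EE d))) hρs φ.contDiff_normed (hc.locallyIntegrable)
    exact this
  · intro x y
    rw [← integral_sub (hint x) (hint y)]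
    simp_rw [← mul_sub]
    refine gen _ _ fun t => ?_
    rw [abs_mul, abs_of_nonneg (hρ0 t), mul_comm]
    have := h.lip (x-t) (y-t)
    rw [sub_sub_sub_cancel_right] at this
    exact mul_le_mul_of_nonneg_right this (hρ0 t)
  · intro x hx
    refine integral_eq_zero_of_ae (Filter.Eventually.of_forall fun t => ?_)
    simp only [Pi.zero_apply]
    rcases le_or_gt ε ‖t‖ with ht | ht
    · rw [hρz t ht, zero_mul]
    · rw [h.supp (x-t), mul_zero]
      have := norm_sub_norm_le x t
      linarith
  · intro x
    refine gen _ _ fun t => ?_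
    rw [abs_mul, abs_of_nonneg (hρ0 t), mul_comm]
    exact mul_le_mul_of_nonneg_right (h.bd _) (hρ0 t)
  · intro x
    have e : η x = ∫ t, ρ t * η x := by rw [integral_mul_const, hρ1, one_mul]
    rw [e, ← integral_sub (hint x) (hρi.mul_const _)]
    simp_rw [← mul_sub]
    refine gen _ _ fun t => ?_
    rw [abs_mul, abs_of_nonneg (hρ0 t), mul_comm]
    rcases le_or_gt ε ‖t‖ with ht | ht
    · rw [hρz t ht]; simp
    · refine mul_le_mul_of_nonneg_right ?_ (hρ0 t)
      refine (h.lip _ _).trans (mul_le_mul_of_nonneg_left ?_ h.L0)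
      rw [show x - t - x = -t by abel, norm_neg]; exact ht.le

lemma Good.double {d : ℕ} {r L M : ℝ} {η : EE d → ℝ} (h : Good d r L M η)
    (hd : 1 ≤ d) (s : ℝ) (hs0 : 0 < s) (hs1 : s < 1) :
    ∫ x : EE d, ∫ y : EE d, (η x - η y)^2 / ‖x - y‖ ^ ((d : ℝ) + 2*s) =
    ∫ p : EE d × EE d, (η p.1 - η (p.1 + p.2))^2 * KK d s p.2 := by
  have hi := (h.int_sq hd s hs0 hs1).1
  rw [Measure.volume_eq_prod] at hi ⊢
  rw [integral_prod _ hi]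
  congr 1; ext x
  rw [← integral_add_left_eq_self _ x]
  congr 1; ext z
  rw [show x - (x+z) = -z by abel, norm_neg]
  simp [KK, div_eq_mul_inv]

lemma Good.stab {d : ℕ} {r L M : ℝ} {η : EE d → ℝ} (h : Good d r L M η)
    (hd : 1 ≤ d) (s : ℝ) (hs0 : 0 < s) (hs1 : s < 1) (c : ℝ) (g : EE d → ℝ) (hg : Continuous g)
    (hst : ∀ η : EE d → ℝ, ContDiff ℝ (⊤ : ℕ∞) η → HasCompactSupport η →
      ∫ x : EE d, g x * (η x)^2 ≤
      c / 2 * ∫ x : EE d, ∫ y : EE d, (η x - η y)^2 / ‖x - y‖ ^ ((d : ℝ) + 2*s)) :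
    ∫ x, g x * (η x)^2 ≤ c / 2 * ∫ p : EE d × EE d, (η p.1 - η (p.1 + p.2))^2 * KK d s p.2 := by
  have hε : ∀ n : ℕ, 0 < (1:ℝ)/(n+1) ∧ (1:ℝ)/(n+1) ≤ 1 := fun n => by
    constructor
    · positivity
    · rw [div_le_one (by positivity)]; linarith [(Nat.cast_nonneg n : (0:ℝ) ≤ n)]
  choose ζ hζs hζg hζd using fun n : ℕ => h.mollify (1/(n+1)) (hε n).1 (hε n).2
  have hlim : ∀ x, Filter.Tendsto (fun n => ζ n x) Filter.atTop (nhds (η x)) := by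
    intro x
    rw [tendsto_iff_dist_tendsto_zero]
    have : Filter.Tendsto (fun n : ℕ => L * (1/((n:ℝ)+1))) Filter.atTop (nhds 0) := by
      simpa using tendsto_one_div_add_atTop_nhds_zero_nat.const_mul L
    exact squeeze_zero (fun _ => dist_nonneg) (fun n => by rw [Real.dist_eq]; exact hζd n x) this
  have hineq : ∀ n, ∫ x, g x * (ζ n x)^2 ≤
      c / 2 * ∫ p : EE d × EE d, (ζ n p.1 - ζ n (p.1 + p.2))^2 * KK d s p.2 := by
    intro n
    rw [← (hζg n).double hd s hs0 hs1]
    exact hst _ (hζs n) (hζg n).cs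
  refine le_of_tendsto_of_tendsto' (b := Filter.atTop) ?_ (Filter.Tendsto.const_mul (c/2) ?_) hineq
  · refine tendsto_integral_of_dominated_convergence
      (fun x => (closedBall (0 : EE d) (r+1)).indicator (fun x => |g x| * M^2) x) ?_ ?_ ?_ ?_
    · intro n
      exact (hg.mul ((hζg n).cont.pow 2)).aestronglyMeasurable
    · rw [integrable_indicator_iff measurableSet_closedBall]
      exact (Continuous.continuousOn (by fun_prop)).integrableOn_compact (isCompact_closedBall _ _)
    · intro n
      refine Filter.Eventually.of_forall fun x => ?_
      by_cases hx : x ∈ closedBall (0 : EE d) (r+1)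
      · rw [indicator_of_mem hx, Real.norm_eq_abs, abs_mul, abs_pow]
        gcongr
        exact (hζg n).bd x
      · rw [indicator_of_notMem hx]
        simp only [mem_closedBall, dist_zero_right, not_le] at hx
        rw [(hζg n).supp x hx.le]; simp
    · exact Filter.Eventually.of_forall fun x => ((hlim x).pow 2).const_mul _
  · refine tendsto_integral_of_dominated_convergence (fun p => (L^2 + 4*M^2) * dom d s (r+1) p)
      ?_ ?_ ?_ ?_
    · intro n; exact ((hζg n).int_sq hd s hs0 hs1).1.1
    · exact (dom_integrable d hd s hs0 hs1 _).const_mul _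
    · intro n
      exact Filter.Eventually.of_forall ((hζg n).int_sq hd s hs0 hs1).2
    · exact Filter.Eventually.of_forall fun p =>
        (((hlim p.1).sub (hlim (p.1+p.2))).pow 2).mul_const _


lemma C1_lip {d : ℕ} {w : EE d → ℝ} (hw : ContDiff ℝ 2 w) (r : ℝ) :
    ∃ A : ℝ, 0 ≤ A ∧ ∀ x y, ‖x‖ ≤ r → ‖y‖ ≤ r → |w x - w y| ≤ A * ‖x - y‖ := by
  have hc : Continuous (fderiv ℝ w) := hw.continuous_fderiv (by norm_num)
  obtain ⟨A, hA⟩ := (isCompact_closedBall (0 : EE d) r).exists_bound_of_continuousOn hc.continuousOn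
  refine ⟨max A 0, le_max_right _ _, fun x y hx hy => ?_⟩
  have := (convex_closedBall (0 : EE d) r).norm_image_sub_le_of_norm_fderiv_le (𝕜 := ℝ) (f := w)
    (C := max A 0) (x := y) (y := x)
    (fun x _ => (hw.differentiable (by norm_num)).differentiableAt)
    (fun x hx => (hA x hx).trans (le_max_left _ _)) (by simpa using hy) (by simpa using hx)
  simpa using this

lemma C2_snd {d : ℕ} {w : EE d → ℝ} (hw : ContDiff ℝ 2 w) (r : ℝ) :
    ∃ B : ℝ, 0 ≤ B ∧ ∀ x z, ‖x‖ ≤ r → ‖z‖ ≤ 1 →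
      |2 * w x - w (x + z) - w (x - z)| ≤ B * ‖z‖^2 := by
  have h1 : ContDiff ℝ 1 (fderiv ℝ w) := hw.fderiv_right (by norm_num)
  have hc : Continuous (fderiv ℝ (fderiv ℝ w)) := h1.continuous_fderiv (by norm_num)
  obtain ⟨A, hA⟩ := (isCompact_closedBall (0 : EE d) (r+1)).exists_bound_of_continuousOn
    (f := fderiv ℝ (fderiv ℝ w)) hc.continuousOn
  set B := max A 0 with hB
  have hB0 : 0 ≤ B := le_max_right _ _
  have hdiff : Differentiable ℝ w := hw.differentiable (by norm_num)
  have hL : ∀ x y : EE d, ‖x‖ ≤ r+1 → ‖y‖ ≤ r+1 → ‖fderiv ℝ w x - fderiv ℝ w y‖ ≤ B * ‖x - y‖ := by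
    intro x y hx hy
    exact (convex_closedBall (0 : EE d) (r+1)).norm_image_sub_le_of_norm_fderiv_le (𝕜 := ℝ)
      (f := fderiv ℝ w) (C := B) (x := y) (y := x)
      (fun x _ => (h1.differentiable (by norm_num)).differentiableAt)
      (fun x hx => (hA x hx).trans (le_max_left _ _)) (by simpa using hy) (by simpa using hx)
  have key : ∀ x z : EE d, ‖x‖ ≤ r → ‖z‖ ≤ 1 → |w (x+z) - w x - fderiv ℝ w x z| ≤ B * ‖z‖^2 := by
    intro x z hx hz
    have := (convex_closedBall x ‖z‖).norm_image_sub_le_of_norm_fderiv_le' (𝕜 := ℝ)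
      (f := w) (C := B * ‖z‖) (x := x) (y := x + z) (φ := fderiv ℝ w x)
      (fun y _ => hdiff.differentiableAt)
      (fun y hy => by
        rw [mem_closedBall, dist_eq_norm] at hy
        refine (hL y x ?_ (by linarith)).trans (mul_le_mul_of_nonneg_left hy hB0)
        have := norm_le_norm_add_norm_sub' y x
        linarith) (by simp) (by simp)
    rw [Real.norm_eq_abs, add_sub_cancel_left] at this
    calc _ ≤ _ := this
      _ = _ := by ring
  refine ⟨2*B, by positivity, fun x z hx hz => ?_⟩
  have k1 := key x z hx hz
  have k2 := key x (-z) hx (by simpa using hz)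
  rw [norm_neg, map_neg, ← sub_eq_add_neg] at k2
  rw [abs_le] at *
  constructor <;> linarith [k1.1, k1.2, k2.1, k2.2]

lemma C2_snd' {d : ℕ} {w : EE d → ℝ} (hw : ContDiff ℝ 2 w) {N : ℝ} (hN : ∀ x, |w x| ≤ N) (r : ℝ) :
    ∃ B : ℝ, 0 ≤ B ∧ ∀ x z, ‖x‖ ≤ r →
      |2 * w x - w (x + z) - w (x - z)| ≤ B * min 1 (‖z‖^2) := by
  obtain ⟨B, hB0, hB⟩ := C2_snd hw r
  have hN0 : 0 ≤ N := (abs_nonneg _).trans (hN 0)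
  refine ⟨B + 4*N, by positivity, fun x z hx => ?_⟩
  have hn : |2 * w x - w (x + z) - w (x - z)| ≤ 4*N := by
    have a := abs_le.1 (hN x); have b := abs_le.1 (hN (x+z)); have c := abs_le.1 (hN (x-z))
    rw [abs_le]; constructor <;> linarith
  rcases le_total 1 (‖z‖^2) with h | h
  · rw [min_eq_left h]; linarith
  · rw [min_eq_right h]
    have hz : ‖z‖ ≤ 1 := by
      by_contra hc; push Not at hc; nlinarith
    have := hB x z hx hz
    nlinarith [sq_nonneg ‖z‖]

lemma snd_int {d : ℕ} (hd : 1 ≤ d) (s : ℝ) (hs0 : 0 < s) (hs1 : s < 1)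
    {w : EE d → ℝ} (hw : ContDiff ℝ 2 w) {N : ℝ} (hN : ∀ x, |w x| ≤ N) (x : EE d) :
    Integrable (fun z => (2 * w x - w (x + z) - w (x - z)) * KK d s z) := by
  obtain ⟨B, hB0, hB⟩ := C2_snd' hw hN ‖x‖
  have hc := hw.continuous
  refine ((kap_integrable d hd s hs0 hs1).const_mul B).mono' ?_ (Filter.Eventually.of_forall fun z => ?_)
  · refine Measurable.aestronglyMeasurable (Measurable.mul ?_ (KK_meas d s))
    exact Continuous.measurable (by fun_prop)
  · rw [Real.norm_eq_abs, abs_mul, abs_of_nonneg (KK_nonneg _ _ _), kap, ← mul_assoc]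
    exact mul_le_mul_of_nonneg_right (hB x z le_rfl) (KK_nonneg _ _ _)

lemma Good.weak {d : ℕ} {r L M : ℝ} {ψ : EE d → ℝ} (h : Good d r L M ψ)
    (hd : 1 ≤ d) (s : ℝ) (hs0 : 0 < s) (hs1 : s < 1)
    {w : EE d → ℝ} (hw : ContDiff ℝ 2 w) {N : ℝ} (hN : ∀ x, |w x| ≤ N) :
    Integrable (fun p : EE d × EE d =>
      ((ψ p.1 - ψ (p.1 + p.2)) * (w p.1 - w (p.1 + p.2))) * KK d s p.2) ∧
    ∫ x, ψ x * ∫ z, (2 * w x - w (x + z) - w (x - z)) * KK d s z =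
    ∫ p : EE d × EE d, ((ψ p.1 - ψ (p.1 + p.2)) * (w p.1 - w (p.1 + p.2))) * KK d s p.2 := by
  have hc := hw.continuous
  have hψ := h.cont
  have hM0 := h.M0
  have hL0 := h.L0
  have hN0 : 0 ≤ N := (abs_nonneg _).trans (hN 0)
  obtain ⟨B, hB0, hB⟩ := C2_snd' hw hN r
  obtain ⟨A, hA0, hA⟩ := C1_lip hw (r+1)
  have i1 := (int_of_bound d hd s hs0 hs1 r (M*B) (by positivity)
    (fun p => ψ p.1 * (2 * w p.1 - w (p.1 + p.2) - w (p.1 - p.2)))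
    (Continuous.measurable (by fun_prop))
    (fun p h1 h2 => by simp [h.supp _ h1])
    (fun p => by
      rcases le_or_gt r ‖p.1‖ with hr | hr
      · rw [h.supp _ hr]; simp; positivity
      · rw [abs_mul, mul_assoc]
        exact mul_le_mul (h.bd _) (hB _ _ hr.le) (abs_nonneg _) hM0)).1
  have i2 := (int_of_bound d hd s hs0 hs1 r (L*A + 4*M*N) (by positivity)
    (fun p => (ψ p.1 - ψ (p.1 + p.2)) * (w p.1 - w (p.1 + p.2)))
    (Continuous.measurable (by fun_prop))
    (fun p h1 h2 => by simp [h.supp _ h1, h.supp _ h2])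
    (fun p => by
      obtain ⟨x, z⟩ := p
      dsimp only
      have hb1 : |ψ x - ψ (x+z)| ≤ 2*M := by
        have := abs_sub (ψ x) (ψ (x+z)); linarith [h.bd x, h.bd (x+z)]
      have hb2 : |w x - w (x+z)| ≤ 2*N := by
        have := abs_sub (w x) (w (x+z)); linarith [hN x, hN (x+z)]
      rw [abs_mul]
      rcases le_total 1 (‖z‖^2) with hz | hz
      · rw [min_eq_left hz]
        have := mul_le_mul hb1 hb2 (abs_nonneg _) (by positivity)
        nlinarith [mul_nonneg hL0 hA0]
      · rw [min_eq_right hz]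
        have hz1 : ‖z‖ ≤ 1 := by
          by_contra hc; push Not at hc; nlinarith
        by_cases hr : ‖x‖ < r ∨ ‖x+z‖ < r
        · have hx : ‖x‖ ≤ r+1 ∧ ‖x+z‖ ≤ r+1 := by
            have a1 := norm_add_le x z
            have a2 := norm_sub_le (x+z) z
            rw [add_sub_cancel_right] at a2
            rcases hr with hr | hr <;> constructor <;> linarith
          have b1 := h.lip x (x+z)
          have b2 := hA x (x+z) hx.1 hx.2
          rw [show x - (x+z) = -z by abel, norm_neg] at b1 b2
          have := mul_le_mul b1 b2 (abs_nonneg _) (by positivity)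
          nlinarith [mul_nonneg (mul_nonneg hM0 hN0) (sq_nonneg ‖z‖)]
        · push Not at hr
          rw [h.supp _ hr.1, h.supp _ hr.2]; simp; positivity)).1
  refine ⟨i2, ?_⟩
  have hL1 : ∫ x, ψ x * ∫ z, (2 * w x - w (x + z) - w (x - z)) * KK d s z =
      ∫ p : EE d × EE d, ψ p.1 * (2 * w p.1 - w (p.1 + p.2) - w (p.1 - p.2)) * KK d s p.2 := by
    rw [Measure.volume_eq_prod] at i1 ⊢
    rw [integral_prod _ i1]
    congr 1; ext x
    rw [← integral_const_mul]
    congr 1; ext z; ring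
  rw [hL1]
  rw [Measure.volume_eq_prod] at i1 i2 ⊢
  rw [integral_prod_symm _ i1, integral_prod_symm _ i2]
  congr 1; ext z
  dsimp only
  rw [integral_mul_const, integral_mul_const]
  congr 1
  have c1 : Integrable (fun x => ψ x * (w x - w (x+z))) :=
    Continuous.integrable_of_hasCompactSupport (by fun_prop) h.cs.mul_right
  have c2 : Integrable (fun x => ψ x * (w x - w (x-z))) :=
    Continuous.integrable_of_hasCompactSupport (by fun_prop) h.cs.mul_right
  have e2 : ∫ x, ψ x * (w x - w (x-z)) = ∫ x, ψ (x+z) * (w (x+z) - w x) := by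
    rw [← integral_add_right_eq_self _ z]
    simp
  have c3 : Integrable (fun x => ψ (x+z) * (w (x+z) - w x)) := by
    have := c2.comp_add_right z
    simpa using this
  have : ∀ x, ψ x * (2 * w x - w (x + z) - w (x - z)) =
    ψ x * (w x - w (x+z)) + ψ x * (w x - w (x-z)) := fun x => by ring
  simp_rw [this]
  rw [integral_add c1 c2, e2, ← integral_add c1 c3]
  congr 1; ext x; ring


lemma oneD (g g1 g2 : ℝ → ℝ) (h A B : ℝ) (hh : 0 < h) 
    (d1 : ∀ t ∈ Icc (-h) h, HasDerivAt g (g1 t) t) (d2 : ∀ t ∈ Icc (-h) h, HasDerivAt g1 (g2 t) t)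
    (b1 : ∀ t ∈ Icc (-h) h, |g1 t| ≤ A) (b2 : ∀ t ∈ Icc (-h) h, |g2 t| ≤ B) :
    |g h - g 0| ≤ A * h ∧ |g (-h) - g 0| ≤ A * h ∧ |g h + g (-h) - 2 * g 0| ≤ 2 * B * h^2 := by
  have m0 : (0:ℝ) ∈ Icc (-h) h := ⟨by linarith, hh.le⟩
  have mh : h ∈ Icc (-h) h := ⟨by linarith, le_rfl⟩
  have mn : -h ∈ Icc (-h) h := ⟨le_rfl, by linarith⟩
  have hB0 : 0 ≤ B := (abs_nonneg _).trans (b2 0 m0)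
  have l1 : ∀ t ∈ Icc (-h) h, |g t - g 0| ≤ A * |t - 0| := fun t ht =>
    (convex_Icc (-h) h).norm_image_sub_le_of_norm_hasDerivWithin_le
      (fun t ht => (d1 t ht).hasDerivWithinAt) b1 m0 ht
  have l2 : ∀ t ∈ Icc (-h) h, |g1 t - g1 0| ≤ B * |t - 0| := fun t ht =>
    (convex_Icc (-h) h).norm_image_sub_le_of_norm_hasDerivWithin_le
      (fun t ht => (d2 t ht).hasDerivWithinAt) b2 m0 ht
  have l3 : ∀ t ∈ Icc (-h) h, |(g t - g1 0 * t) - (g 0 - g1 0 * 0)| ≤ (B * h) * |t - 0| := fun t ht =>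
    (convex_Icc (-h) h).norm_image_sub_le_of_norm_hasDerivWithin_le
      (f := fun t => g t - g1 0 * t) (f' := fun t => g1 t - g1 0)
      (fun t ht => by
        have := (d1 t ht).sub ((hasDerivAt_id t).const_mul (g1 0))
        simp only [mul_one] at this
        exact this.hasDerivWithinAt)
      (fun t ht => (l2 t ht).trans (mul_le_mul_of_nonneg_left (by
        rw [sub_zero, abs_le]; exact ht) hB0)) m0 ht
  have k1 := l1 h mh
  have k2 := l1 (-h) mn
  have k3 := l3 h mh
  have k4 := l3 (-h) mn
  simp only [sub_zero, abs_neg, abs_of_pos hh] at k1 k2 k3 k4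
  refine ⟨k1, k2, ?_⟩
  rw [abs_le] at *
  constructor <;> nlinarith [k3.1, k3.2, k4.1, k4.2]

lemma KK_diff (d : ℕ) (s : ℝ) (hs0 : 0 < s) : ∃ c : ℝ, 0 < c ∧
    ∀ (z v : EE d) (h : ℝ), ‖v‖ = 1 → 0 < h → 2 * h ≤ ‖z‖ →
    |KK d s (z - h • v) - KK d s z| * ‖z‖ ≤ c * h * KK d s z ∧
    |KK d s (z + h • v) + KK d s (z - h • v) - 2 * KK d s z| * ‖z‖^2 ≤ c * h^2 * KK d s z := by
  set m : ℝ := ((d : ℝ) + 2*s)/2 with hm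
  have hm0 : 0 < m := by positivity
  refine ⟨(12 * m + 2 * (m * (m+1) * 144 + 8 * m)) * 4 ^ m, by positivity, ?_⟩
  intro z v h hv hh hz
  have hzp : 0 < ‖z‖ := by linarith
  set b : ℝ := inner ℝ z v with hb
  set q : ℝ → ℝ := fun t => ‖z‖^2 + 2 * t * b + t^2 with hq
  have hqn : ∀ t, ‖z + t • v‖^2 = q t := by
    intro t
    rw [norm_add_sq_real, norm_smul, hv, inner_smul_right, hq, mul_one, Real.norm_eq_abs, sq_abs]
    ring
  have hbz : |b| ≤ ‖z‖ := by
    have := abs_real_inner_le_norm z v; rwa [hv, mul_one] at this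
  have hK : ∀ t, KK d s (z + t • v) = (q t) ^ (-m) := by
    intro t
    rw [KK, ← hqn t, Real.rpow_neg (by positivity), ← Real.rpow_natCast, ← Real.rpow_mul (norm_nonneg _)]
    congr 2; rw [hm]; push_cast; ring
  set Z := ‖z‖^2/4 with hZ
  have hZ0 : 0 < Z := by positivity
  have hqZ : ∀ t ∈ Icc (-h) h, Z ≤ q t := by
    intro t ht
    rw [← hqn t, hZ]
    have h1 : ‖z‖ ≤ ‖z + t • v‖ + ‖t • v‖ := by
      have := norm_sub_le (z + t • v) (t • v); rwa [add_sub_cancel_right] at this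
    rw [norm_smul, hv, mul_one, Real.norm_eq_abs] at h1
    have : |t| ≤ h := abs_le.2 ht
    have : ‖z‖/2 ≤ ‖z + t • v‖ := by linarith
    nlinarith
  have hq0 : ∀ t ∈ Icc (-h) h, 0 < q t := fun t ht => hZ0.trans_le (hqZ t ht)
  have hq' : ∀ t ∈ Icc (-h) h, |2*b + 2*t| ≤ 3 * ‖z‖ := by
    intro t ht
    have h2 : |t| ≤ h := abs_le.2 ht
    rw [abs_le] at *
    constructor <;> linarith [h2.1, h2.2, hbz.1, hbz.2]
  have dq : ∀ t, HasDerivAt q (2*b+2*t) t := by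
    intro t
    have := (((hasDerivAt_id t).const_mul 2).mul_const b).const_add (‖z‖^2) |>.add ((hasDerivAt_id t).pow 2)
    refine this.congr_deriv ?_
    simp
  have hpw : ∀ a : ℝ, 0 ≤ a → ∀ t ∈ Icc (-h) h, (q t) ^ (-a) ≤ Z ^ (-a) := fun a ha t ht =>
    Real.rpow_le_rpow_of_nonpos hZ0 (hqZ t ht) (by linarith)
  have key := oneD (fun t => (q t) ^ (-m)) (fun t => (2*b+2*t) * (-m) * (q t) ^ (-m-1))
    (fun t => 2 * (-m) * (q t) ^ (-m-1) + (2*b+2*t) * (-m) * ((2*b+2*t) * (-m-1) * (q t) ^ (-m-1-1)))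
    h (3*‖z‖ * m * Z ^ (-(m+1))) (2 * m * Z ^ (-(m+1)) + (9*‖z‖^2)* m * ((m+1) * Z ^ (-(m+2)))) hh
    (fun t ht => (dq t).rpow_const (Or.inl (hq0 t ht).ne'))
    (fun t ht => by
      have e1 := (dq t).rpow_const (p := -m-1) (Or.inl (hq0 t ht).ne')
      have e2 : HasDerivAt (fun t : ℝ => (2*b+2*t) * (-m)) (2 * (-m)) t := by
        have := (((hasDerivAt_id t).const_mul 2).const_add (2*b)).mul_const (-m)
        simpa using this
      exact e2.mul e1)
    (fun t ht => by
      have e := hpw (m+1) (by linarith) t ht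
      rw [show -(m+1) = -m-1 by ring] at *
      rw [abs_mul, abs_mul, abs_neg, abs_of_pos hm0, abs_of_pos (Real.rpow_pos_of_pos (hq0 t ht) _)]
      have := hq' t ht
      have := Real.rpow_pos_of_pos (hq0 t ht) (-m-1)
      gcongr)
    (fun t ht => by
      have e := hpw (m+1) (by linarith) t ht
      have e2 := hpw (m+2) (by linarith) t ht
      rw [show -(m+1) = -m-1 by ring] at *
      rw [show -(m+2) = -m-1-1 by ring] at *
      have p1 := Real.rpow_pos_of_pos (hq0 t ht) (-m-1)
      have p2 := Real.rpow_pos_of_pos (hq0 t ht) (-m-1-1)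
      refine (abs_add_le _ _).trans (add_le_add ?_ ?_)
      · rw [abs_mul, abs_mul, abs_neg, abs_of_pos hm0, abs_of_pos p1, abs_two]
        gcongr
      · have : (2*b+2*t) * (-m) * ((2*b+2*t) * (-m-1) * (q t) ^ (-m-1-1)) =
          |2*b+2*t|^2 * m * ((m+1) * (q t) ^ (-m-1-1)) := by rw [sq_abs]; ring
        rw [this, abs_of_nonneg (by positivity)]
        have h3 := pow_le_pow_left₀ (abs_nonneg _) (hq' t ht) 2
        rw [mul_pow] at h3
        norm_num at h3
        norm_num
        gcongr)
  have hKz : KK d s z = (q 0) ^ (-m) := by rw [← hK 0]; simp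
  have hKm : KK d s (z - h • v) = (q (-h)) ^ (-m) := by rw [← hK (-h), neg_smul, sub_eq_add_neg]
  have hT : Z ^ (-m) = 4^m * KK d s z := by
    rw [hKz, hZ, Real.div_rpow (by positivity) (by norm_num), Real.rpow_neg (by norm_num : (0:ℝ) ≤ 4),
      div_inv_eq_mul, mul_comm]
    simp [hq]
  have hZ1 : Z ^ (-(m+1)) = 4^m * KK d s z * (4 / ‖z‖^2) := by
    rw [neg_add, Real.rpow_add hZ0, hT, Real.rpow_neg_one, hZ, inv_div]
  have hZ2 : Z ^ (-(m+2)) = 4^m * KK d s z * (16 / ‖z‖^4) := by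
    rw [neg_add, Real.rpow_add hZ0, hT]
    congr 1
    rw [Real.rpow_neg hZ0.le, hZ]
    norm_num
    field_simp
    norm_num
  obtain ⟨-, k2, k3⟩ := key
  rw [← hKm, ← hKz, hZ1] at k2
  rw [← hKm, ← hKz, ← hK h, hZ1, hZ2] at k3
  have hKn := KK_nonneg d s z
  have h4 : (0:ℝ) < 4^m := by positivity
  constructor
  · calc _ ≤ (3 * ‖z‖ * m * (4 ^ m * KK d s z * (4 / ‖z‖ ^ 2)) * h) * ‖z‖ :=
          mul_le_mul_of_nonneg_right k2 hzp.le
      _ = (12 * m * 4^m) * h * KK d s z := by field_simp; ring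
      _ ≤ _ := by
        gcongr
        have : 0 ≤ 2 * (m * (m + 1) * 144 + 8 * m) := by positivity
        linarith
  · calc _ ≤ _ := mul_le_mul_of_nonneg_right k3 (sq_nonneg ‖z‖)
      _ = (2 * (m * (m+1) * 144 + 8 * m)) * 4^m * h^2 * KK d s z := by field_simp; ring
      _ ≤ _ := by
        gcongr
        have : 0 ≤ 12 * m := by positivity
        linarith

noncomputable def GG (d : ℕ) (s : ℝ) (φ : EE d → ℝ) (x z : EE d) : ℝ := (φ x - φ (x+z))^2 * KK d s z

noncomputable def DG (d : ℕ) (s : ℝ) (φ : EE d → ℝ) (e x z : EE d) : ℝ :=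
  GG d s φ (x - e) z - GG d s φ (x - e) (z + e) - GG d s φ x (z - e) + GG d s φ x z

lemma DG_bound (d : ℕ) (s : ℝ) (hs0 : 0 < s) : ∃ c : ℝ, 0 < c ∧
    ∀ (φ : EE d → ℝ) (L : ℝ), 0 ≤ L → (∀ x y, |φ x - φ y| ≤ L * ‖x - y‖) → 
    ∀ (x z v : EE d) (h : ℝ), ‖v‖ = 1 → 0 < h → 2 * h ≤ ‖z‖ →
    |DG d s φ (h • v) x z| ≤ c * L^2 * h^2 * KK d s z := by
  obtain ⟨c, hc, hK⟩ := KK_diff d s hs0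
  refine ⟨2 + 9/4 * c + 6 * c, by positivity, ?_⟩
  intro φ L hL hφ x z v h hv hh hz
  obtain ⟨k1, k2⟩ := hK z v h hv hh hz
  have hzp : 0 < ‖z‖ := by linarith
  have hKn := KK_nonneg d s z
  have ne : ‖h • v‖ = h := by rw [norm_smul, hv, mul_one, Real.norm_eq_abs, abs_of_pos hh]
  unfold DG GG
  rw [show x - h • v + (z + h • v) = x + z by abel, show x + (z - h • v) = x - h • v + z by abel]
  set a := φ x
  set a' := φ (x - h • v)
  set b := φ (x + z)
  set b' := φ (x - h • v + z)
  have A1 : |a - a'| ≤ L * h := by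
    have := hφ x (x - h • v); rwa [sub_sub_cancel, ne] at this
  have A2 : |b - b'| ≤ L * h := by
    have := hφ (x + z) (x - h • v + z)
    rwa [show x + z - (x - h • v + z) = h • v by abel, ne] at this
  have A3 : |a' - b| ≤ L * (3/2 * ‖z‖) := by
    refine (hφ _ _).trans (mul_le_mul_of_nonneg_left ?_ hL)
    rw [show x - h • v - (x + z) = -(h • v + z) by abel, norm_neg]
    have := norm_add_le (h • v) z
    linarith
  have A4 : |a - b'| ≤ L * (3/2 * ‖z‖) := by
    refine (hφ _ _).trans (mul_le_mul_of_nonneg_left ?_ hL)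
    rw [show x - (x - h • v + z) = h • v - z by abel]
    have := norm_sub_le (h • v) z
    linarith
  set Kp := KK d s (z + h • v)
  set Km := KK d s (z - h • v)
  set K0 := KK d s z
  have id : (a' - b')^2 * K0 - (a' - b)^2 * Kp - (a - b')^2 * Km + (a - b)^2 * K0 =
     - 2 * ((a - a') * (b - b')) * K0 - (a' - b)^2 * (Kp + Km - 2 * K0)
     - (((a - a') + (b - b')) * ((a - b') + (a' - b))) * (Km - K0) := by ring
  rw [id]
  have T1 : |(- 2 * ((a - a') * (b - b')) * K0)| ≤ 2 * L^2 * h^2 * K0 := by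
    rw [abs_mul, abs_mul, abs_mul, abs_of_nonneg hKn]
    norm_num
    have := mul_le_mul A1 A2 (abs_nonneg _) (by positivity)
    nlinarith
  have T2 : |(a' - b)^2 * (Kp + Km - 2 * K0)| ≤ 9/4 * c * L^2 * h^2 * K0 := by
    rw [abs_mul, abs_pow]
    have := pow_le_pow_left₀ (abs_nonneg _) A3 2
    calc _ ≤ (L * (3/2 * ‖z‖))^2 * |Kp + Km - 2 * K0| := mul_le_mul_of_nonneg_right this (abs_nonneg _)
      _ = (9/4 * L^2) * (|Kp + Km - 2 * K0| * ‖z‖^2) := by ring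
      _ ≤ (9/4 * L^2) * (c * h^2 * K0) := mul_le_mul_of_nonneg_left k2 (by positivity)
      _ = _ := by ring
  have T3 : |(((a - a') + (b - b')) * ((a - b') + (a' - b))) * (Km - K0)| ≤ 6 * c * L^2 * h^2 * K0 := by
    rw [abs_mul, abs_mul]
    have B1 : |(a - a') + (b - b')| ≤ 2 * (L * h) := (abs_add_le _ _).trans (by linarith)
    have B2 : |(a - b') + (a' - b)| ≤ 3 * L * ‖z‖ := (abs_add_le _ _).trans (by linarith)
    have := mul_le_mul B1 B2 (abs_nonneg _) (by positivity)
    calc _ ≤ (2 * (L * h) * (3 * L * ‖z‖)) * |Km - K0| := mul_le_mul_of_nonneg_right this (abs_nonneg _)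
      _ = (6 * L^2 * h) * (|Km - K0| * ‖z‖) := by ring
      _ ≤ (6 * L^2 * h) * (c * h * K0) := mul_le_mul_of_nonneg_left k1 (by positivity)
      _ = _ := by ring
  refine (abs_sub _ _).trans ?_
  refine (add_le_add (abs_sub _ _) le_rfl).trans ?_
  calc _ ≤ 2 * L^2 * h^2 * K0 + 9/4 * c * L^2 * h^2 * K0 + 6 * c * L^2 * h^2 * K0 :=
        add_le_add (add_le_add T1 T2) T3
    _ = _ := by ring


noncomputable def UK (d : ℕ) (s : ℝ) (u : EE d → ℝ) (R : ℝ) (p : EE d × EE d) : ℝ :=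
  {p : EE d × EE d | ‖p.1‖ < R ∨ ‖p.1 + p.2‖ < R}.indicator
    (fun p => (u p.1 - u (p.1 + p.2))^2 * KK d s p.2) p

lemma Js_eq (d : ℕ) (s : ℝ) (u : EE d → ℝ) (hu : Continuous u) (R : ℝ)
    (hJ : Js d s u (ball (0 : EE d) R) ≠ ⊤) :
    Integrable (UK d s u R) ∧ ENNReal.ofReal (∫ p, UK d s u R p) = Js d s u (ball (0 : EE d) R) := by
  have hms : MeasurableSet {p : EE d × EE d | ‖p.1‖ < R ∨ ‖p.1 + p.2‖ < R} :=
    (IsOpen.union (isOpen_lt (f := fun p : EE d × EE d => ‖p.1‖) (g := fun _ => R)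
      (by fun_prop) (by fun_prop))
      (isOpen_lt (f := fun p : EE d × EE d => ‖p.1 + p.2‖) (g := fun _ => R)
      (by fun_prop) (by fun_prop))).measurableSet
  have hUm : Measurable (UK d s u R) := by
    refine Measurable.indicator ?_ hms
    refine Measurable.mul ?_ ((KK_meas d s).comp measurable_snd)
    exact Continuous.measurable (by fun_prop)
  have hU0 : ∀ p, 0 ≤ UK d s u R p := fun p =>
    indicator_nonneg (fun p _ => mul_nonneg (sq_nonneg _) (KK_nonneg _ _ _)) _
  have e : Js d s u (ball (0 : EE d) R) = ∫⁻ p, ENNReal.ofReal (UK d s u R p) := by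
    have mp := measurePreserving_prod_add (volume : Measure (EE d)) (volume : Measure (EE d))
    have hmT : MeasurableSet (((ball (0 : EE d) R)ᶜ ×ˢ (ball (0 : EE d) R)ᶜ)ᶜ) :=
      (measurableSet_ball.compl.prod measurableSet_ball.compl).compl
    unfold Js
    rw [← lintegral_indicator hmT, Measure.volume_eq_prod]
    rw [← mp.lintegral_comp]
    · congr 1; ext p
      by_cases h : ‖p.1‖ < R ∨ ‖p.1 + p.2‖ < R
      · rw [indicator_of_mem, UK, indicator_of_mem]
        · rw [show p.1 - (p.1+p.2) = -p.2 by abel, norm_neg, KK, div_eq_mul_inv]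
        · exact h
        · simp only [mem_compl_iff, mem_prod, mem_ball, dist_zero_right]; tauto
      · rw [indicator_of_notMem, UK, indicator_of_notMem, ENNReal.ofReal_zero]
        · exact h
        · simp only [mem_compl_iff, mem_prod, mem_ball, dist_zero_right]; tauto
    · refine Measurable.indicator ?_ hmT
      have := hu.measurable
      fun_prop
  rw [e] at hJ ⊢
  have hI : Integrable (UK d s u R) :=
    (lintegral_ofReal_ne_top_iff_integrable hUm.aestronglyMeasurable
      (Filter.Eventually.of_forall hU0)).1 hJ
  exact ⟨hI, ofReal_integral_eq_lintegral_ofReal hI (Filter.Eventually.of_forall hU0)⟩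

lemma GG_translate {d : ℕ} (H : EE d → EE d → ℝ) (hH : Integrable (fun p : EE d × EE d => H p.1 p.2))
    (U : EE d → EE d → ℝ) (hU : Continuous (fun p : EE d × EE d => U p.1 p.2))
    (hb : ∀ x z, |U x z| ≤ 4) (a b : EE d) :
    Integrable (fun p : EE d × EE d => H p.1 p.2 * U (p.1 + a) (p.2 + b)) ∧
    Integrable (fun p : EE d × EE d => H (p.1 - a) (p.2 - b) * U p.1 p.2) ∧
    ∫ p : EE d × EE d, H p.1 p.2 * U (p.1 + a) (p.2 + b) =
    ∫ p : EE d × EE d, H (p.1 - a) (p.2 - b) * U p.1 p.2 := by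
  haveI : (volume : Measure (EE d × EE d)).IsAddRightInvariant := by
    rw [Measure.volume_eq_prod]; exact Measure.prod.instIsAddRightInvariant
  have h2 : Integrable (fun p : EE d × EE d => H (p.1 - a) (p.2 - b) * U p.1 p.2) := by
    have := hH.comp_sub_right ((a, b) : EE d × EE d)
    exact this.mul_bdd hU.aestronglyMeasurable (c := 4) (Filter.Eventually.of_forall fun p => hb _ _)
  have h1 := h2.comp_add_right ((a, b) : EE d × EE d)
  have e := integral_add_right_eq_self (μ := (volume : Measure (EE d × EE d)))
    (fun p : EE d × EE d => H (p.1 - a) (p.2 - b) * U p.1 p.2) ((a, b) : EE d × EE d)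
  simp only [Prod.fst_add, Prod.snd_add, add_sub_cancel_right] at h1 e
  exact ⟨h1, h2, e⟩

lemma int4 {α : Type*} [MeasurableSpace α] {μ : Measure α} {f1 f2 f3 f4 : α → ℝ}
    (i1 : Integrable f1 μ) (i2 : Integrable f2 μ) (i3 : Integrable f3 μ) (i4 : Integrable f4 μ) :
    ∫ a, (f1 a - f2 a - f3 a + f4 a) ∂μ =
      (∫ a, f1 a ∂μ) - (∫ a, f2 a ∂μ) - (∫ a, f3 a ∂μ) + ∫ a, f4 a ∂μ := by
  have h12 : Integrable (fun a => f1 a - f2 a) μ := i1.sub i2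
  have h123 : Integrable (fun a => f1 a - f2 a - f3 a) μ := h12.sub i3
  rw [integral_add h123 i4, integral_sub h12 i3, integral_sub i1 i2]

lemma ibp {d : ℕ} {s r L M : ℝ} {φ : EE d → ℝ} (h : Good d r L M φ)
    (hd : 1 ≤ d) (hs0 : 0 < s) (hs1 : s < 1) (u : EE d → ℝ) (hu : Continuous u)
    (hb : ∀ x, |u x| ≤ 1) (e : EE d) :
    Integrable (fun p : EE d × EE d => (u p.1 - u (p.1+p.2))^2 * DG d s φ e p.1 p.2) ∧
    ∫ p : EE d × EE d, GG d s φ p.1 p.2 * ((u (p.1 + e) - u p.1) * (u (p.1 + p.2 + e) - u (p.1 + p.2))) =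
    -(1/2) * ∫ p : EE d × EE d, (u p.1 - u (p.1+p.2))^2 * DG d s φ e p.1 p.2 := by
  have hH : Integrable (fun p : EE d × EE d => GG d s φ p.1 p.2) := (h.int_sq hd s hs0 hs1).1
  have T := GG_translate (GG d s φ) hH (fun x z => (u x - u (x+z))^2) (by fun_prop) (fun x z => by
    have a := abs_le.1 (hb x); have b := abs_le.1 (hb (x+z))
    rw [abs_of_nonneg (sq_nonneg _)]; nlinarith)
  obtain ⟨i1, j1, e1⟩ := T e 0
  obtain ⟨i2, j2, e2⟩ := T e (-e)
  obtain ⟨i3, j3, e3⟩ := T 0 e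
  obtain ⟨i4, j4, e4⟩ := T 0 0
  simp only [sub_zero, add_zero, sub_neg_eq_add] at *
  constructor
  · refine (((j1.sub j2).sub j3).add j4).congr (Filter.Eventually.of_forall fun p => ?_)
    simp only [Pi.sub_apply, Pi.add_apply, DG]; ring
  · have l : ∫ p : EE d × EE d, GG d s φ p.1 p.2 * ((u (p.1 + e) - u p.1) * (u (p.1 + p.2 + e) - u (p.1 + p.2)))
      = -(1/2) * ((((∫ p : EE d × EE d, GG d s φ p.1 p.2 * (u (p.1+e) - u (p.1 + e + p.2))^2)
        - ∫ p : EE d × EE d, GG d s φ p.1 p.2 * (u (p.1+e) - u (p.1 + e + (p.2 + -e)))^2)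
        - ∫ p : EE d × EE d, GG d s φ p.1 p.2 * (u (p.1) - u (p.1 + (p.2 + e)))^2)
        + ∫ p : EE d × EE d, GG d s φ p.1 p.2 * (u (p.1) - u (p.1 + p.2))^2) := by
      rw [← int4 i1 i2 i3 i4, ← integral_const_mul]
      congr 1; ext p
      rw [show p.1 + e + (p.2 + -e) = p.1 + p.2 by abel, show p.1 + (p.2 + e) = p.1 + p.2 + e by abel,
        show p.1 + e + p.2 = p.1 + p.2 + e by abel]
      ring
    rw [l, e1, e2, e3]
    rw [← int4 j1 j2 j3 j4]
    congr 2; ext p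
    simp only [DG]; ring

noncomputable def Gd (d : ℕ) (s : ℝ) (φ : EE d → ℝ) (δ : ℝ) (x z : EE d) : ℝ :=
  (ball (0 : EE d) δ).indicator (fun z => GG d s φ x z) z

lemma GG_nonneg (d : ℕ) (s : ℝ) (φ : EE d → ℝ) (x z : EE d) : 0 ≤ GG d s φ x z :=
  mul_nonneg (sq_nonneg _) (KK_nonneg _ _ _)

lemma Gd_nonneg (d : ℕ) (s : ℝ) (φ : EE d → ℝ) (δ : ℝ) (x z : EE d) : 0 ≤ Gd d s φ δ x z :=
  indicator_nonneg (fun _ _ => GG_nonneg _ _ _ _ _) _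

lemma Gd_meas {d : ℕ} (s : ℝ) {φ : EE d → ℝ} (h : Continuous φ) (δ : ℝ) :
    Measurable (fun p : EE d × EE d => Gd d s φ δ p.1 p.2) := by
  have : (fun p : EE d × EE d => Gd d s φ δ p.1 p.2) =
    (Prod.snd ⁻¹' ball (0 : EE d) δ).indicator (fun p : EE d × EE d => GG d s φ p.1 p.2) := by
    ext p; simp [Gd, indicator]
  rw [this]
  refine Measurable.indicator ?_ (measurable_snd measurableSet_ball)
  refine Measurable.mul ?_ ((KK_meas d s).comp measurable_snd)
  exact Continuous.measurable (by fun_prop)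

lemma Gd_le (d : ℕ) (s : ℝ) (φ : EE d → ℝ) (δ : ℝ) (x z : EE d) : Gd d s φ δ x z ≤ GG d s φ x z :=
  indicator_le_self' (fun _ _ => GG_nonneg _ _ _ _ _) _

lemma Gd_int {d : ℕ} {s r L M : ℝ} {φ : EE d → ℝ} (h : Good d r L M φ)
    (hd : 1 ≤ d) (hs0 : 0 < s) (hs1 : s < 1) (δ : ℝ) :
    Integrable (fun p : EE d × EE d => Gd d s φ δ p.1 p.2) := by
  have hH : Integrable (fun p : EE d × EE d => GG d s φ p.1 p.2) := (h.int_sq hd s hs0 hs1).1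
  refine hH.mono' (Gd_meas s h.cont δ).aestronglyMeasurable (Filter.Eventually.of_forall fun p => ?_)
  rw [Real.norm_eq_abs, abs_of_nonneg (Gd_nonneg _ _ _ _ _ _)]
  exact Gd_le _ _ _ _ _ _

lemma Gd_tendsto {d : ℕ} {s r L M : ℝ} {φ : EE d → ℝ} (h : Good d r L M φ)
    (hd : 1 ≤ d) (hs0 : 0 < s) (hs1 : s < 1) (δ : ℕ → ℝ)
    (hδ : Filter.Tendsto δ Filter.atTop (nhds 0)) :
    Filter.Tendsto (fun n => ∫ p : EE d × EE d, Gd d s φ (δ n) p.1 p.2) Filter.atTop (nhds 0) := by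
  have hH : Integrable (fun p : EE d × EE d => GG d s φ p.1 p.2) := (h.int_sq hd s hs0 hs1).1
  have := tendsto_integral_of_dominated_convergence (μ := (volume : Measure (EE d × EE d)))
    (F := fun n p => Gd d s φ (δ n) p.1 p.2) (f := fun _ => 0) (fun p => GG d s φ p.1 p.2)
    (fun n => (Gd_meas s h.cont _).aestronglyMeasurable) hH
    (fun n => Filter.Eventually.of_forall fun p => by
      rw [Real.norm_eq_abs, abs_of_nonneg (Gd_nonneg _ _ _ _ _ _)]
      exact Gd_le _ _ _ _ _ _)
    (Filter.Eventually.of_forall fun p => by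
      refine tendsto_const_nhds.congr' ?_
      by_cases hp : p.2 = 0
      · refine Filter.Eventually.of_forall fun n => ?_
        refine le_antisymm (Gd_nonneg _ _ _ _ _ _) ((Gd_le _ _ _ _ _ _).trans ?_)
        simp [GG, hp]
      · have : 0 < ‖p.2‖ := norm_pos_iff.2 hp
        filter_upwards [hδ.eventually (gt_mem_nhds this)] with n hn
        rw [Gd, indicator_of_notMem]
        simpa using hn.le)
  simpa using this

lemma main_bound {d : ℕ} {s L M R : ℝ} {φ : EE d → ℝ} (h : Good d (3/4*R) L M φ) (hR : 1 ≤ R)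
    (hd : 1 ≤ d) (hs0 : 0 < s) (hs1 : s < 1) (u : EE d → ℝ) (hu : Continuous u)
    (hb : ∀ x, |u x| ≤ 1) (v : EE d) (hv : ‖v‖ = 1) (t : ℝ) (ht : 0 < t) (ht1 : t ≤ 1/4)
    (A : ℝ) (hA0 : 0 ≤ A) (hA : ∀ x y, ‖x‖ ≤ R+1 → ‖y‖ ≤ R+1 → |u x - u y| ≤ A * ‖x - y‖)
    (c : ℝ) (hc0 : 0 ≤ c) (hc : ∀ x z : EE d, 2 * t ≤ ‖z‖ →
      |DG d s φ (t • v) x z| ≤ c * L^2 * t^2 * KK d s z)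
    (hi : Integrable (UK d s u R)) :
    ∫ p : EE d × EE d, GG d s φ p.1 p.2 *
      ((u (p.1 + t • v) - u p.1) * (u (p.1 + p.2 + t • v) - u (p.1 + p.2))) ≤
    t^2 * (1/2 * c * L^2 * (∫ p, UK d s u R p) 
      + 8 * A^2 * ∫ p : EE d × EE d, Gd d s φ (3*t) p.1 p.2) := by
  set e := t • v with he
  have ne : ‖e‖ = t := by rw [he, norm_smul, hv, mul_one, Real.norm_eq_abs, abs_of_pos ht]
  obtain ⟨hint, heq⟩ := ibp h hd hs0 hs1 u hu hb e
  have hgi := Gd_int h hd hs0 hs1 (3*t)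
  have T := GG_translate (Gd d s φ (3*t)) hgi (fun x z => 1) (by fun_prop) (fun x z => by norm_num)
  obtain ⟨-, j1, e1⟩ := T e 0
  obtain ⟨-, j2, e2⟩ := T e (-e)
  obtain ⟨-, j3, e3⟩ := T 0 e
  simp only [sub_zero, sub_neg_eq_add, mul_one] at j1 j2 j3 e1 e2 e3
  have supp0 : ∀ x : EE d, R ≤ ‖x‖ → φ x = 0 ∧ φ (x - e) = 0 := by
    intro x hx
    have := norm_sub_norm_le x e
    exact ⟨h.supp _ (by linarith), h.supp _ (by linarith)⟩
  have pt : ∀ p : EE d × EE d, |(u p.1 - u (p.1+p.2))^2 * DG d s φ e p.1 p.2| ≤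
      c * L^2 * t^2 * UK d s u R p + 4 * A^2 * t^2 * (Gd d s φ (3*t) (p.1 - e) p.2
       + Gd d s φ (3*t) (p.1 - e) (p.2 + e) + Gd d s φ (3*t) p.1 (p.2 - e) + Gd d s φ (3*t) p.1 p.2) := by
    rintro ⟨x, z⟩
    dsimp only
    have n1 := Gd_nonneg d s φ (3*t) (x - e) z
    have n2 := Gd_nonneg d s φ (3*t) (x - e) (z + e)
    have n3 := Gd_nonneg d s φ (3*t) x (z - e)
    have n4 := Gd_nonneg d s φ (3*t) x z
    by_cases hS : ‖x‖ < R ∨ ‖x + z‖ < R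
    · have hUK : UK d s u R (x, z) = (u x - u (x+z))^2 * KK d s z := by
        rw [UK, indicator_of_mem]; exact hS
      rw [abs_mul, abs_of_nonneg (sq_nonneg _), hUK]
      rcases le_or_gt (2*t) ‖z‖ with hz | hz
      · have := mul_le_mul_of_nonneg_left (hc x z hz) (sq_nonneg (u x - u (x+z)))
        have m : 0 ≤ 4 * A^2 * t^2 * (Gd d s φ (3*t) (x - e) z
          + Gd d s φ (3*t) (x - e) (z + e) + Gd d s φ (3*t) x (z - e) + Gd d s φ (3*t) x z) := by
          positivity
        linarith
      · have hx : ‖x‖ ≤ R+1 ∧ ‖x+z‖ ≤ R+1 := by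
            have a1 := norm_add_le x z
            have a2 := norm_sub_le (x+z) z
            rw [add_sub_cancel_right] at a2
            rcases hS with hr | hr <;> constructor <;> linarith
        have b2 := hA x (x+z) hx.1 hx.2
        rw [show x - (x+z) = -z by abel, norm_neg] at b2
        have b3 : |u x - u (x+z)| ≤ A * (2*t) := b2.trans (mul_le_mul_of_nonneg_left hz.le hA0)
        have b4 := pow_le_pow_left₀ (abs_nonneg _) b3 2
        rw [sq_abs] at b4
        have z1 : ‖z + e‖ < 3*t := by have := norm_add_le z e; linarith
        have z2 : ‖z - e‖ < 3*t := by have := norm_sub_le z e; linarith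
        have z3 : ‖z‖ < 3*t := by linarith
        have g1 : ∀ y z : EE d, ‖z‖ < 3*t → Gd d s φ (3*t) y z = GG d s φ y z := by
          intro y z hz
          rw [Gd, indicator_of_mem]; simpa using hz
        rw [g1 _ _ z1, g1 _ _ z2, g1 _ _ z3, g1 _ _ z3] 
        rw [g1 _ _ z1] at n2
        rw [g1 _ _ z2] at n3
        rw [g1 _ _ z3] at n1 n4
        have b5 : |DG d s φ e x z| ≤ GG d s φ (x - e) z + GG d s φ (x - e) (z + e)
          + GG d s φ x (z - e) + GG d s φ x z := by
          unfold DG; rw [abs_le]; constructor <;> linarith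
        have b6 := mul_le_mul b4 b5 (abs_nonneg _) (by positivity)
        have : 0 ≤ c * L^2 * t^2 * ((u x - u (x+z))^2 * KK d s z) := by
          have := KK_nonneg d s z; positivity
        nlinarith
    · push Not at hS
      have s1 := supp0 x hS.1
      have s2 := supp0 (x+z) hS.2
      have hUK : UK d s u R (x, z) = 0 := by
        rw [UK, indicator_of_notMem]; simpa using hS
      have : DG d s φ e x z = 0 := by
        unfold DG GG
        rw [show x - e + z = x + z - e by abel, show x - e + (z + e) = x + z by abel,
          show x + (z - e) = x + z - e by abel, s1.1, s1.2, s2.1, s2.2]; simp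
      rw [this, hUK]; simp; positivity
  rw [heq]
  have hsum := ((j1.add j2).add j3).add hgi
  have st : |∫ p : EE d × EE d, (u p.1 - u (p.1+p.2))^2 * DG d s φ e p.1 p.2| ≤
      ∫ p : EE d × EE d, (c * L^2 * t^2 * UK d s u R p + 4 * A^2 * t^2 * (Gd d s φ (3*t) (p.1 - e) p.2
       + Gd d s φ (3*t) (p.1 - e) (p.2 + e) + Gd d s φ (3*t) p.1 (p.2 - e) + Gd d s φ (3*t) p.1 p.2)) := by
    rw [← Real.norm_eq_abs]
    exact norm_integral_le_of_norm_le ((hi.const_mul _).add (hsum.const_mul _))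
      (Filter.Eventually.of_forall pt)
  have ev : ∫ p : EE d × EE d, (c * L^2 * t^2 * UK d s u R p + 4 * A^2 * t^2 * (Gd d s φ (3*t) (p.1 - e) p.2
       + Gd d s φ (3*t) (p.1 - e) (p.2 + e) + Gd d s φ (3*t) p.1 (p.2 - e) + Gd d s φ (3*t) p.1 p.2))
     = c * L^2 * t^2 * (∫ p, UK d s u R p) + 4 * A^2 * t^2 * (4 * ∫ p : EE d × EE d, Gd d s φ (3*t) p.1 p.2) := by
    refine (integral_add (hi.const_mul _) (hsum.const_mul _)).trans ?_
    rw [integral_const_mul, integral_const_mul]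
    congr 2
    refine (integral_add ((j1.add j2).add j3) hgi).trans ?_
    have q1 := (integral_add (j1.add j2) j3)
    have q2 := (integral_add j1 j2)
    simp only [Pi.add_apply] at q1 q2 ⊢
    rw [q1, q2, ← e1, ← e2, ← e3]; ring
  rw [ev] at st
  have := (abs_le.1 st).1
  nlinarith


lemma Good.mul {d : ℕ} {r L M A N : ℝ} {φ w : EE d → ℝ} (h : Good d r L M φ)
    (hA0 : 0 ≤ A) (hA : ∀ x y, ‖x‖ ≤ r → ‖y‖ ≤ r → |w x - w y| ≤ A * ‖x - y‖)
    (hN : ∀ x, |w x| ≤ N) : Good d r (M * A + N * L) (M * N) (fun x => φ x * w x) := by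
  have hM0 := h.M0
  have hL0 := h.L0
  have hN0 : 0 ≤ N := (abs_nonneg _).trans (hN 0)
  have one : ∀ x y, r ≤ ‖y‖ → |φ x * w x - φ y * w y| ≤ (M * A + N * L) * ‖x - y‖ := by
    intro x y hy
    have e := h.lip x y
    rw [h.supp y hy, sub_zero] at e
    rw [h.supp y hy, zero_mul, sub_zero, abs_mul]
    have := mul_le_mul e (hN x) (abs_nonneg _) (by positivity)
    have : 0 ≤ M * A * ‖x - y‖ := by positivity
    nlinarith
  refine ⟨fun x y => ?_, fun x hx => by simp [h.supp x hx], fun x => ?_, by positivity⟩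
  · rcases le_or_gt r ‖y‖ with hy | hy
    · exact one x y hy
    rcases le_or_gt r ‖x‖ with hx | hx
    · rw [abs_sub_comm, norm_sub_rev]; exact one y x hx
    have e : φ x * w x - φ y * w y = φ x * (w x - w y) + w y * (φ x - φ y) := by ring
    rw [e]
    refine (abs_add_le _ _).trans ?_
    rw [abs_mul, abs_mul]
    have a1 := mul_le_mul (h.bd x) (hA x y hx.le hy.le) (abs_nonneg _) hM0
    have a2 := mul_le_mul (hN y) (h.lip x y) (abs_nonneg _) hN0
    nlinarith
  · rw [abs_mul]; exact mul_le_mul (h.bd x) (hN x) (abs_nonneg _) hM0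

lemma Good.abs {d : ℕ} {r L M : ℝ} {φ : EE d → ℝ} (h : Good d r L M φ) :
    Good d r L M (fun x => |φ x|) :=
  ⟨fun x y => (abs_abs_sub_abs_le_abs_sub _ _).trans (h.lip x y), fun x hx => by simp [h.supp x hx],
    fun x => by rw [abs_abs]; exact h.bd x, h.L0⟩

noncomputable def cut (d : ℕ) (R : ℝ) (x : EE d) : ℝ := max 0 (min 1 (3 - 4/R * ‖x‖))

lemma cut_good (d : ℕ) (R : ℝ) (hR : 1 ≤ R) : Good d (3/4*R) (4/R) 1 (cut d R) := by
  have hR0 : 0 < R := by linarith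
  refine ⟨fun x y => ?_, fun x hx => ?_, fun x => ?_, by positivity⟩
  · unfold cut
    refine (abs_max_sub_max_le_max _ _ _ _).trans ?_
    simp only [sub_self, abs_zero]
    refine max_le (by positivity) ((abs_min_sub_min_le_max _ _ _ _).trans ?_)
    simp only [sub_self, abs_zero]
    refine max_le (by positivity) ?_
    rw [show 3 - 4/R * ‖x‖ - (3 - 4/R * ‖y‖) = 4/R * (‖y‖ - ‖x‖) by ring, abs_mul,
      abs_of_pos (by positivity : 0 < 4/R), abs_sub_comm]
    exact mul_le_mul_of_nonneg_left (abs_norm_sub_norm_le x y) (by positivity)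
  · have : 3 ≤ 4/R * ‖x‖ := by
      calc (3:ℝ) = 4/R * (3/4*R) := by field_simp
        _ ≤ _ := mul_le_mul_of_nonneg_left hx (by positivity)
    unfold cut
    exact max_eq_left ((min_le_right _ _).trans (by linarith))
  · unfold cut
    rw [abs_of_nonneg (le_max_left _ _)]
    exact max_le zero_le_one (min_le_left _ _)

lemma cut_one (d : ℕ) (R : ℝ) (hR : 1 ≤ R) (x : EE d) (hx : ‖x‖ < 1/2) : cut d R x = 1 := by
  have hR0 : 0 < R := by linarith
  have : 4/R * ‖x‖ ≤ 2 := by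
    rw [div_mul_eq_mul_div, div_le_iff₀ hR0]; linarith
  unfold cut
  rw [min_eq_left (by linarith), max_eq_right zero_le_one]

lemma fracC_pos (d : ℕ) (s : ℝ) (hs0 : 0 < s) (hs1 : s < 1) : 0 < fracC d s := by
  unfold fracC
  have h1 : 0 < Real.Gamma ((d:ℝ)/2 + s) := Real.Gamma_pos_of_pos (by positivity)
  have h2 : Real.Gamma (-s) ≠ 0 := by
    refine Real.Gamma_ne_zero fun m hm => ?_
    have : s = m := by linarith
    rcases Nat.eq_zero_or_pos m with h | h
    · subst h; simp at this; linarith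
    · have : (1:ℝ) ≤ m := by exact_mod_cast h
      linarith
  have := abs_pos.2 h2
  have := Real.pi_pos
  positivity

lemma c1a_cont {d : ℕ} {f f' : ℝ → ℝ} {α : ℝ} (hα : 0 < α) (hf : IsC1Alpha f f' α)
    {u : EE d → ℝ} (hu : Continuous u) (hb : ∀ x, |u x| ≤ 1) :
    Continuous (fun x => f' (u x)) ∧ Continuous (fun x => f (u x)) := by
  obtain ⟨h1, Ca, hC0, hC⟩ := hf
  have hm : ∀ x, u x ∈ Icc (-1:ℝ) 1 := fun x => abs_le.1 (hb x)
  constructor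
  · rw [continuous_iff_continuousAt]
    intro x
    rw [ContinuousAt, tendsto_iff_dist_tendsto_zero]
    have hl : Filter.Tendsto (fun y => Ca * |u y - u x| ^ α) (nhds x) (nhds (Ca * |u x - u x| ^ α)) := by
      have : Continuous (fun y => Ca * |u y - u x| ^ α) := by
        refine continuous_const.mul (Continuous.rpow_const (by fun_prop) (fun _ => Or.inr hα.le))
      exact this.continuousAt
    rw [sub_self, abs_zero, Real.zero_rpow hα.ne', mul_zero] at hl
    exact squeeze_zero (fun _ => dist_nonneg)
      (fun y => by rw [Real.dist_eq]; exact hC _ (hm y) _ (hm x)) hl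
  · rw [continuous_iff_continuousAt]
    intro x
    exact ContinuousAt.comp (h1 _ (hm x)).continuousAt hu.continuousAt

lemma c1a_mv {f f' : ℝ → ℝ} {α Ca : ℝ} (hα : 0 < α)
    (h1 : ∀ x ∈ Set.Icc (-1 : ℝ) 1, HasDerivAt f (f' x) x) (hC0 : 0 ≤ Ca)
    (hC : ∀ x ∈ Set.Icc (-1 : ℝ) 1, ∀ y ∈ Set.Icc (-1 : ℝ) 1, |f' x - f' y| ≤ Ca * |x - y| ^ α)
    (a b : ℝ) (ha : a ∈ Icc (-1:ℝ) 1) (hb : b ∈ Icc (-1:ℝ) 1) :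
    |f b - f a - f' a * (b - a)| ≤ Ca * |b - a| ^ α * |b - a| := by
  have hsub : uIcc a b ⊆ Icc (-1:ℝ) 1 := by
    intro y hy
    rw [mem_uIcc] at hy
    constructor <;> rcases hy with hy | hy <;> linarith [ha.1, ha.2, hb.1, hb.2, hy.1, hy.2]
  have := (convex_uIcc a b).norm_image_sub_le_of_norm_hasDerivWithin_le
    (f := fun y => f y - f' a * y) (f' := fun y => f' y - f' a) (C := Ca * |b - a| ^ α)
    (fun y hy => by
      have := (h1 y (hsub hy)).sub ((hasDerivAt_id y).const_mul (f' a))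
      simp only [mul_one] at this
      exact this.hasDerivWithinAt)
    (fun y hy => by
      refine (hC y (hsub hy) a ha).trans (mul_le_mul_of_nonneg_left ?_ hC0)
      exact Real.rpow_le_rpow (abs_nonneg _) (abs_sub_left_of_mem_uIcc hy) hα.le)
    left_mem_uIcc right_mem_uIcc
  rw [Real.norm_eq_abs, Real.norm_eq_abs] at this
  convert this using 2
  ring

lemma lower {d : ℕ} {s r L M : ℝ} {η : EE d → ℝ} (h : Good d r L M η)
    (hd : 1 ≤ d) (hs0 : 0 < s) (hs1 : s < 1) (w : EE d → ℝ)
    (hw : ∀ x, ‖x‖ < 1/2 → η x = w x) :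
    4 * ((∫ x in ball (0 : EE d) (1/2), max (w x) 0) * ∫ x in ball (0 : EE d) (1/2), max (-(w x)) 0) ≤
    (∫ p : EE d × EE d, (η p.1 - η (p.1 + p.2))^2 * KK d s p.2)
     - ∫ p : EE d × EE d, (|η p.1| - |η (p.1 + p.2)|)^2 * KK d s p.2 := by
  have i1 := (h.int_sq hd s hs0 hs1).1
  have i2 := (h.abs.int_sq hd s hs0 hs1).1
  have hc := h.cont
  set α : EE d → ℝ := (ball (0 : EE d) (1/2)).indicator (fun x => max (η x) 0) with hα
  set β : EE d → ℝ := (ball (0 : EE d) (1/2)).indicator (fun x => max (-(η x)) 0) with hβ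
  have eα : ∫ x in ball (0 : EE d) (1/2), max (w x) 0 = ∫ x, α x := by
    rw [hα, integral_indicator measurableSet_ball]
    exact setIntegral_congr_fun measurableSet_ball fun x hx => by
      rw [hw x (by simpa using hx)]
  have eβ : ∫ x in ball (0 : EE d) (1/2), max (-(w x)) 0 = ∫ x, β x := by
    rw [hβ, integral_indicator measurableSet_ball]
    exact setIntegral_congr_fun measurableSet_ball fun x hx => by
      rw [hw x (by simpa using hx)]
  have iα : Integrable α := by
    rw [hα, integrable_indicator_iff measurableSet_ball]
    exact ((Continuous.continuousOn (by fun_prop)).integrableOn_compact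
      (isCompact_closedBall (0 : EE d) (1/2))).mono_set ball_subset_closedBall
  have iβ : Integrable β := by
    rw [hβ, integrable_indicator_iff measurableSet_ball]
    exact ((Continuous.continuousOn (by fun_prop)).integrableOn_compact
      (isCompact_closedBall (0 : EE d) (1/2))).mono_set ball_subset_closedBall
  have i3 : Integrable (fun p : EE d × EE d => α p.1 * β (p.1 + p.2)) := by
    have mp := measurePreserving_prod_add (volume : Measure (EE d)) (volume : Measure (EE d))
    exact mp.integrable_comp_of_integrable (iα.mul_prod iβ)
  have e3 : ∫ p : EE d × EE d, α p.1 * β (p.1 + p.2) = (∫ x, α x) * ∫ x, β x := by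
    rw [Measure.volume_eq_prod] at i3 ⊢
    rw [integral_prod _ i3, ← integral_mul_const]
    congr 1; ext x
    dsimp only
    rw [integral_const_mul, integral_add_left_eq_self β x]
  rw [eα, eβ, ← e3, ← integral_const_mul, ← integral_sub i1 i2]
  refine integral_mono (i3.const_mul 4) (i1.sub i2) ?_
  rintro ⟨x, z⟩
  simp only [Pi.sub_apply]
  have K0 := KK_nonneg d s z
  have hid : (η x - η (x+z))^2 * KK d s z - (|η x| - |η (x+z)|)^2 * KK d s z =
      2 * (|η x * η (x+z)| - η x * η (x+z)) * KK d s z := by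
    rw [abs_mul, sub_sq, sub_sq, sq_abs, sq_abs]; ring
  rw [hid]
  have hnn : 0 ≤ 2 * (|η x * η (x+z)| - η x * η (x+z)) * KK d s z := by
    have := le_abs_self (η x * η (x+z))
    exact mul_nonneg (by linarith) K0
  by_cases hx : x ∈ ball (0 : EE d) (1/2)
  swap
  · simp only [hα, indicator_of_notMem hx]; simpa using hnn
  by_cases hy : x + z ∈ ball (0 : EE d) (1/2)
  swap
  · simp only [hβ, indicator_of_notMem hy]; simpa using hnn
  simp only [hα, hβ, indicator_of_mem hx, indicator_of_mem hy]
  rcases le_or_gt (η x) 0 with h1 | h1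
  · rw [max_eq_right h1]; simpa using hnn
  rcases le_or_gt 0 (η (x+z)) with h2 | h2
  · rw [max_eq_right (by linarith : -(η (x+z)) ≤ 0)]; simpa using hnn
  have hz : z ≠ 0 := by
    rintro rfl; rw [add_zero] at h2; linarith
  have hz1 : ‖z‖ ≤ 1 := by
    simp only [mem_ball, dist_zero_right] at hx hy
    have := norm_sub_le (x+z) x
    rw [add_sub_cancel_left] at this
    linarith
  have hK : 1 ≤ KK d s z := by
    unfold KK
    have : 0 < ‖z‖ := norm_pos_iff.2 hz
    exact (one_le_inv₀ (by positivity)).2 (Real.rpow_le_one (norm_nonneg _) hz1 (by positivity))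
  have hneg : η x * η (x+z) < 0 := mul_neg_of_pos_of_neg h1 h2
  rw [max_eq_left h1.le, max_eq_left (by linarith), abs_of_neg hneg]
  nlinarith


lemma diffq_eq {d : ℕ} (hd : 1 ≤ d) (s : ℝ) (hs0 : 0 < s) (hs1 : s < 1) {f : ℝ → ℝ} {u : EE d → ℝ}
    (hu : ContDiff ℝ 2 u) (hb : ∀ x, |u x| ≤ 1) (c : ℝ)
    (heq : ∀ x : EE d, c / 2 * ∫ y : EE d,
      (2 * u x - u (x + y) - u (x - y)) / ‖y‖ ^ ((d : ℝ) + 2*s) = f (u x)) (e : EE d) (t : ℝ) (x : EE d) :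
    c / 2 * ∫ z, (2 * ((u (x + e) - u x) / t) - (u (x + z + e) - u (x + z)) / t
      - (u (x - z + e) - u (x - z)) / t) * KK d s z = (f (u (x + e)) - f (u x)) / t := by
  have k : ∀ x : EE d, c / 2 * ∫ z, (2 * u x - u (x + z) - u (x - z)) * KK d s z = f (u x) := heq
  rw [← k x, ← k (x + e), ← mul_sub, ← integral_sub (snd_int hd s hs0 hs1 hu hb _)
    (snd_int hd s hs0 hs1 hu hb _), mul_div_assoc, ← integral_div]
  congr 2
  ext z
  rw [show x + e + z = x + z + e by abel, show x + e - z = x - z + e by abel]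
  ring

lemma step {d : ℕ} {s L R : ℝ} {φ : EE d → ℝ} (h : Good d (3/4*R) L 1 φ) (hR : 1 ≤ R)
    (h1 : ∀ x, ‖x‖ < 1/2 → φ x = 1)
    (hd : 1 ≤ d) (hs0 : 0 < s) (hs1 : s < 1) {f f' : ℝ → ℝ} {u : EE d → ℝ}
    (hS : IsStableSolution d s f f' u) {α : ℝ} (hα : 0 < α) (hf : IsC1Alpha f f' α) 
    (Ca : ℝ) (hC0 : 0 ≤ Ca)
    (hC : ∀ x ∈ Set.Icc (-1 : ℝ) 1, ∀ y ∈ Set.Icc (-1 : ℝ) 1, |f' x - f' y| ≤ Ca * |x - y| ^ α)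
    (v : EE d) (hv : ‖v‖ = 1) (t : ℝ) (ht : 0 < t) (ht1 : t ≤ 1/4)
    (A : ℝ) (hA0 : 0 ≤ A) (hA : ∀ x y, ‖x‖ ≤ R+1 → ‖y‖ ≤ R+1 → |u x - u y| ≤ A * ‖x - y‖)
    (c : ℝ) (hc0 : 0 ≤ c) (hc : ∀ x z : EE d, 2 * t ≤ ‖z‖ →
      |DG d s φ (t • v) x z| ≤ c * L^2 * t^2 * KK d s z)
    (hi : Integrable (UK d s u R)) :
    4 * ((∫ x in ball (0 : EE d) (1/2), max ((u (x + t • v) - u x) / t) 0) *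
      ∫ x in ball (0 : EE d) (1/2), max (-((u (x + t • v) - u x) / t)) 0) ≤
    1/2 * c * L^2 * (∫ p, UK d s u R p)
      + 8 * A^2 * (∫ p : EE d × EE d, Gd d s φ (3*t) p.1 p.2)
      + (2 / fracC d s) * (A * (Ca * (A * t) ^ α * A) * volume.real (ball (0 : EE d) R)) := by
  obtain ⟨hu, hb, heq, hst⟩ := hS
  obtain ⟨cf', cf⟩ := c1a_cont hα hf hu.continuous hb
  have hcp := fracC_pos d s hs0 hs1
  have hmain := main_bound h hR hd hs0 hs1 u hu.continuous hb v hv t ht ht1 A hA0 hA c hc0 hc hi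
  set e := t • v with he
  have ne : ‖e‖ = t := by rw [he, norm_smul, hv, mul_one, Real.norm_eq_abs, abs_of_pos ht]
  set w : EE d → ℝ := fun x => (u (x + e) - u x) / t with hw
  have hwC : ContDiff ℝ 2 w := by
    have : ContDiff ℝ 2 (fun x => u (x + e)) := hu.comp (contDiff_id.add contDiff_const)
    exact (this.sub hu).div_const t
  have hwN : ∀ x, |w x| ≤ 2 / t := by
    intro x
    simp only [hw]
    rw [abs_div, abs_of_pos ht]
    have := abs_sub (u (x + e)) (u x)
    have := hb x
    have := hb (x + e)
    gcongr
    linarith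
  have hwA : ∀ x, ‖x‖ < R → |w x| ≤ A := by
    intro x hx
    have := hA (x + e) x ((norm_add_le _ _).trans (by linarith)) (by linarith)
    rw [add_sub_cancel_left, ne] at this
    simp only [hw]
    rw [abs_div, abs_of_pos ht, div_le_iff₀ ht]
    exact this
  obtain ⟨B, hB0, hB⟩ := C1_lip hwC (3/4*R)
  have hη := h.mul hB0 hB hwN
  set η : EE d → ℝ := fun x => φ x * w x with hηd
  have hψ := h.mul hη.L0 (fun x y _ _ => hη.lip x y) hη.bd
  set ψ : EE d → ℝ := fun x => φ x * η x with hψd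
  obtain ⟨i1, w1⟩ := hψ.weak hd s hs0 hs1 hwC hwN
  have i2 := (hη.int_sq hd s hs0 hs1).1
  have hlow := lower hη hd hs0 hs1 w (fun x hx => by simp [hηd, h1 x hx])
  have hstab := hη.abs.stab hd s hs0 hs1 (fracC d s) (fun x => f' (u x)) cf' hst
  simp only [sq_abs] at hstab
  -- algebra
  have e1 : (∫ p : EE d × EE d, (η p.1 - η (p.1 + p.2))^2 * KK d s p.2)
      - ∫ p : EE d × EE d, ((ψ p.1 - ψ (p.1 + p.2)) * (w p.1 - w (p.1 + p.2))) * KK d s p.2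
      = (∫ p : EE d × EE d, GG d s φ p.1 p.2 *
      ((u (p.1 + e) - u p.1) * (u (p.1 + p.2 + e) - u (p.1 + p.2)))) / t^2 := by
    rw [← integral_sub i2 i1, ← integral_div]
    congr 1
    ext p
    simp only [hψd, hηd, hw, GG]
    field_simp
    ring
  have e2 : ∀ x, (∫ z, (2 * w x - w (x + z) - w (x - z)) * KK d s z)
      = 2 / fracC d s * ((f (u (x + e)) - f (u x)) / t) := by
    intro x
    rw [← diffq_eq hd s hs0 hs1 hu hb _ heq e t x]
    simp only [hw]
    field_simp
  simp only [e2] at w1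
  have cη := hη.cont
  have cψ := hψ.cont
  have cfe : Continuous (fun x => f (u (x + e))) := cf.comp (continuous_id.add continuous_const)
  have j1 : Integrable (fun x => ψ x * ((f (u (x + e)) - f (u x)) / t)) := by
    refine Continuous.integrable_of_hasCompactSupport ?_ hψ.cs.mul_right
    exact cψ.mul ((cfe.sub cf).div_const t)
  have j2 : Integrable (fun x => f' (u x) * η x ^ 2) := by
    refine Continuous.integrable_of_hasCompactSupport (cf'.mul (cη.pow 2)) ?_
    have : HasCompactSupport (fun x => η x * (f' (u x) * η x)) := hη.cs.mul_right
    have e0 : (fun x => f' (u x) * η x ^ 2) = fun x => η x * (f' (u x) * η x) := by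
      funext x; ring
    rw [e0]; exact this
  have e3 : ∫ p : EE d × EE d, ((ψ p.1 - ψ (p.1 + p.2)) * (w p.1 - w (p.1 + p.2))) * KK d s p.2
      = 2 / fracC d s * ∫ x, ψ x * ((f (u (x + e)) - f (u x)) / t) := by
    rw [← w1, ← integral_const_mul]
    congr 1
    ext x
    ring
  have e4 : (∫ x, ψ x * ((f (u (x + e)) - f (u x)) / t)) - ∫ x, f' (u x) * η x ^ 2 ≤
      A * (Ca * (A * t) ^ α * A) * volume.real (ball (0 : EE d) R) := by
    rw [← integral_sub j1 j2]
    have hz : ∀ x ∉ ball (0 : EE d) R, ψ x * ((f (u (x + e)) - f (u x)) / t) - f' (u x) * η x ^ 2 = 0 := by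
      intro x hx
      have hx' : R ≤ ‖x‖ := by simpa using hx
      have := h.supp x (by linarith)
      simp [hψd, hηd, this]
    rw [← setIntegral_eq_integral_of_forall_compl_eq_zero hz]
    refine (le_abs_self _).trans ?_
    rw [← Real.norm_eq_abs]
    refine norm_setIntegral_le_of_norm_le_const measure_ball_lt_top ?_
    intro x hx
    have hx' : ‖x‖ < R := by simpa using hx
    have m := c1a_mv hα hf.1 hC0 hC (u x) (u (x + e)) (abs_le.1 (hb _)) (abs_le.1 (hb _))
    have hwe : u (x + e) - u x = t * w x := by simp only [hw]; field_simp
    rw [hwe, abs_mul, abs_of_pos ht] at m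
    have hwa := hwA x hx'
    have p1 : |ψ x * ((f (u (x + e)) - f (u x)) / t) - f' (u x) * η x ^ 2| =
       (|φ x|^2 * |w x|) * (|f (u (x + e)) - f (u x) - f' (u x) * (t * w x)| / t) := by
      rw [← abs_of_pos ht, ← abs_div, ← abs_pow, ← abs_mul, ← abs_mul, abs_of_pos ht]
      congr 1
      simp only [hψd, hηd]
      field_simp
    rw [Real.norm_eq_abs, p1]
    have q1 : |φ x|^2 * |w x| ≤ A := by
      have := h.bd x
      have : |φ x|^2 ≤ 1 := pow_le_one₀ (abs_nonneg _) this
      nlinarith [abs_nonneg (w x)]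
    refine mul_le_mul q1 ?_ (by positivity) hA0
    rw [div_le_iff₀ ht]
    refine m.trans ?_
    have : (t * |w x|) ^ α ≤ (A * t) ^ α := 
      Real.rpow_le_rpow (by positivity) (by nlinarith) hα.le
    calc Ca * (t * |w x|) ^ α * (t * |w x|) ≤ Ca * (A * t) ^ α * (t * A) := by gcongr
      _ = _ := by ring
  have e5 : (∫ p : EE d × EE d, GG d s φ p.1 p.2 *
      ((u (p.1 + e) - u p.1) * (u (p.1 + p.2 + e) - u (p.1 + p.2)))) / t^2 ≤ 
      (1/2 * c * L^2 * (∫ p, UK d s u R p) 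
      + 8 * A^2 * ∫ p : EE d × EE d, Gd d s φ (3*t) p.1 p.2) := by
    rw [div_le_iff₀ (by positivity), mul_comm]; exact hmain
  have e6 : 2 / fracC d s * (∫ x, f' (u x) * η x ^ 2) ≤
     ∫ p : EE d × EE d, (|η p.1| - |η (p.1 + p.2)|)^2 * KK d s p.2 := by
    have := mul_le_mul_of_nonneg_left hstab (show 0 ≤ 2 / fracC d s by positivity)
    refine this.trans (le_of_eq ?_)
    field_simp
  have e7 := mul_le_mul_of_nonneg_left e4 (show 0 ≤ 2 / fracC d s by positivity)
  rw [mul_sub] at e7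
  linarith

lemma limit_bound {d : ℕ} {s R : ℝ} (hR : 1 ≤ R)
    (hd : 1 ≤ d) (hs0 : 0 < s) (hs1 : s < 1) {f f' : ℝ → ℝ} {u : EE d → ℝ}
    (hS : IsStableSolution d s f f' u) {α : ℝ} (hα : 0 < α) (hf : IsC1Alpha f f' α) 
    (v : EE d) (hv : ‖v‖ = 1) (c : ℝ) (hc0 : 0 ≤ c) 
    (hc : ∀ (φ : EE d → ℝ) (L : ℝ), 0 ≤ L → (∀ x y, |φ x - φ y| ≤ L * ‖x - y‖) → 
      ∀ (x z v : EE d) (h : ℝ), ‖v‖ = 1 → 0 < h → 2 * h ≤ ‖z‖ →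
      |DG d s φ (h • v) x z| ≤ c * L^2 * h^2 * KK d s z)
    (hi : Integrable (UK d s u R)) :
    4 * ((∫ x in ball (0 : EE d) (1/2), max (fderiv ℝ u x v) 0) *
      ∫ x in ball (0 : EE d) (1/2), max (-(fderiv ℝ u x v)) 0) ≤
    1/2 * c * (4/R)^2 * (∫ p, UK d s u R p) := by
  have h := cut_good d R hR
  have h1 := cut_one d R hR
  obtain ⟨Ca, hC0, hC⟩ := hf.2
  have hu := hS.1
  have huc := hu.continuous
  obtain ⟨A, hA0, hA⟩ := C1_lip hu (R+1)
  have tp : ∀ n : ℕ, 0 < (1:ℝ)/((n:ℝ)+4) := fun n => by positivity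
  have tq : ∀ n : ℕ, (1:ℝ)/((n:ℝ)+4) ≤ 1/4 := fun n => by
    gcongr; linarith [(Nat.cast_nonneg n : (0:ℝ) ≤ n)]
  set t : ℕ → ℝ := fun n => 1/((n:ℝ)+4) with htd
  have tl : Filter.Tendsto t Filter.atTop (nhds 0) := by
    refine Filter.Tendsto.div_atTop tendsto_const_nhds ?_
    exact Filter.tendsto_atTop_add_const_right _ _ tendsto_natCast_atTop_atTop
  have tl' : Filter.Tendsto t Filter.atTop (nhdsWithin 0 {0}ᶜ) :=
    tendsto_nhdsWithin_iff.2 ⟨tl, Filter.Eventually.of_forall fun n => (tp n).ne'⟩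
  have hw : ∀ x, Filter.Tendsto (fun n => (u (x + t n • v) - u x) / t n) Filter.atTop
      (nhds (fderiv ℝ u x v)) := by
    intro x
    have := ((hu.differentiable (by norm_num)).differentiableAt (x := x)).hasFDerivAt.hasLineDerivAt v
    have := (hasDerivAt_iff_tendsto_slope_zero.1 this).comp tl'
    simp only [zero_add, zero_smul, add_zero, smul_eq_mul] at this
    refine this.congr fun n => ?_
    simp only [Function.comp]
    ring
  have hwA : ∀ n x, ‖x‖ < 1/2 → |(u (x + t n • v) - u x) / t n| ≤ A := by
    intro n x hx
    have ne : ‖t n • v‖ = t n := by rw [norm_smul, hv, mul_one, Real.norm_eq_abs, abs_of_pos (tp n)]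
    have q : t n ≤ 1/4 := tq n
    have := hA (x + t n • v) x ((norm_add_le _ _).trans (by linarith)) (by linarith)
    rw [add_sub_cancel_left, ne] at this
    rw [abs_div, abs_of_pos (tp n), div_le_iff₀ (tp n)]
    exact this
  have la : Filter.Tendsto (fun n => ∫ x in ball (0 : EE d) (1/2), max ((u (x + t n • v) - u x) / t n) 0)
      Filter.atTop (nhds (∫ x in ball (0 : EE d) (1/2), max (fderiv ℝ u x v) 0)) := by
    refine tendsto_integral_of_dominated_convergence (fun _ => A) ?_ ?_ ?_ ?_
    · intro n; exact Continuous.aestronglyMeasurable (by fun_prop)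
    · exact integrableOn_const measure_ball_lt_top.ne
    · intro n
      refine ae_restrict_of_forall_mem measurableSet_ball fun x hx => ?_
      have := hwA n x (by simpa using hx)
      rw [Real.norm_eq_abs, abs_of_nonneg (le_max_right _ _)]
      exact max_le ((le_abs_self _).trans this) hA0
    · exact Filter.Eventually.of_forall fun x => (hw x).max tendsto_const_nhds
  have lb : Filter.Tendsto (fun n => ∫ x in ball (0 : EE d) (1/2), max (-((u (x + t n • v) - u x) / t n)) 0)
      Filter.atTop (nhds (∫ x in ball (0 : EE d) (1/2), max (-(fderiv ℝ u x v)) 0)) := by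
    refine tendsto_integral_of_dominated_convergence (fun _ => A) ?_ ?_ ?_ ?_
    · intro n; exact Continuous.aestronglyMeasurable (by fun_prop)
    · exact integrableOn_const measure_ball_lt_top.ne
    · intro n
      refine ae_restrict_of_forall_mem measurableSet_ball fun x hx => ?_
      have := hwA n x (by simpa using hx)
      rw [Real.norm_eq_abs, abs_of_nonneg (le_max_right _ _)]
      exact max_le ((neg_le_abs _).trans this) hA0
    · exact Filter.Eventually.of_forall fun x => (hw x).neg.max tendsto_const_nhds
  have lg := Gd_tendsto h hd hs0 hs1 (fun n => 3 * t n) (by simpa using tl.const_mul 3)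
  have lr : Filter.Tendsto (fun n => (A * t n) ^ α) Filter.atTop (nhds 0) := by
    have := (tl.const_mul A).rpow_const (p := α) (Or.inr hα.le)
    rwa [mul_zero, Real.zero_rpow hα.ne'] at this
  have lR : Filter.Tendsto (fun n => 1/2 * c * (4/R)^2 * (∫ p, UK d s u R p)
      + 8 * A^2 * (∫ p : EE d × EE d, Gd d s (cut d R) (3*t n) p.1 p.2)
      + (2 / fracC d s) * (A * (Ca * (A * t n) ^ α * A) * volume.real (ball (0 : EE d) R)))
      Filter.atTop (nhds (1/2 * c * (4/R)^2 * (∫ p, UK d s u R p)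
      + 8 * A^2 * 0 + (2 / fracC d s) * (A * (Ca * 0 * A) * volume.real (ball (0 : EE d) R)))) :=
    (tendsto_const_nhds.add (lg.const_mul _)).add
      (((((lr.const_mul Ca).mul_const A).const_mul A).mul_const _).const_mul _)
  have := le_of_tendsto_of_tendsto' ((la.mul lb).const_mul 4) lR (fun n =>
    step h hR h1 hd hs0 hs1 hS hα hf Ca hC0 hC v hv (t n) (tp n) (tq n) A hA0 hA c hc0
      (fun x z hz => hc _ _ h.L0 h.lip x z v (t n) hv (tp n) hz) hi)
  simpa using this


/-- Let `d ≥ 1`, `0 < s < 1`, `f` be `C^{1,α}` with `α > max{0,1−2s}`, and let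
`u` be a stable solution of `(−Δ)^s u = f(u)` in `ℝ^d` with `|u| ≤ 1`. Then there is
`C = C(d,s)` such that for every unit vector `v` and every `R ≥ 1`:
`(∫_{B_{1/2}} (∂_v u)₊)·(∫_{B_{1/2}} (∂_v u)₋) ≤ C · J^s(u,B_R)/R²`. -/
theorem stmt9 (d : ℕ) (hd : 1 ≤ d) (s : ℝ) (hs0 : 0 < s) (hs1 : s < 1) :
    ∃ C : ℝ, 0 < C ∧ ∀ α : ℝ, max 0 (1 - 2*s) < α → ∀ f f' : ℝ → ℝ, IsC1Alpha f f' α →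
      ∀ u : EuclideanSpace ℝ (Fin d) → ℝ, IsStableSolution d s f f' u →
      ∀ v : EuclideanSpace ℝ (Fin d), ‖v‖ = 1 → ∀ R : ℝ, 1 ≤ R →
      ENNReal.ofReal
          ((∫ x in ball (0 : EuclideanSpace ℝ (Fin d)) (1/2), max (fderiv ℝ u x v) 0) *
           (∫ y in ball (0 : EuclideanSpace ℝ (Fin d)) (1/2), max (-(fderiv ℝ u y v)) 0)) ≤
        ENNReal.ofReal (C / R^2) * Js d s u (ball (0 : EuclideanSpace ℝ (Fin d)) R) := by
  obtain ⟨c, hc0, hc⟩ := DG_bound d s hs0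
  refine ⟨2 * c, by positivity, ?_⟩
  intro α hα f f' hf u hS v hv R hR
  have hR0 : 0 < R := by linarith
  have hα0 : 0 < α := lt_of_le_of_lt (le_max_left _ _) hα
  by_cases hJ : Js d s u (ball (0 : EuclideanSpace ℝ (Fin d)) R) = ⊤
  · rw [hJ, ENNReal.mul_top]
    · exact le_top
    · have : 0 < 2 * c / R^2 := by positivity
      simpa using this
  · obtain ⟨hi, hE⟩ := Js_eq d s u hS.1.continuous R hJ
    have hb := limit_bound hR hd hs0 hs1 hS hα0 hf v hv c hc0.le hc hi
    rw [← hE, ← ENNReal.ofReal_mul (by positivity)]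
    refine ENNReal.ofReal_le_ofReal ?_
    have : 1/2 * c * (4/R)^2 * (∫ p, UK d s u R p) = 4 * (2 * c / R^2 * ∫ p, UK d s u R p) := by
      field_simp
      ring
    rw [this] at hb
    linarith
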